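/- arXiv:1407.2380 — 3 statements merged into one kernel-verified Lean document; each statement's English description precedes it below -/
import Mathlib

section
/- For every sequence (x_n)_{n≥0} in [0,1), the star discrepancy satisfies D_N* ≥ 0.06015 · (log N) / N for infinitely many N. -/
open Real

/-- The star discrepancy of the first `N` points of a sequence `x` in `[0,1)`:
the supremum over `0 < v ≤ 1` of `|A_N([0,v))/N - v|`. -/
noncomputable def starDisc1 (x : ℕ → ℝ) (N : ℕ) : ℝ :=
  sSup { r : ℝ | ∃ v : ℝ, 0 < v ∧ v ≤ 1 ∧
    r = |(Nat.card {n : ℕ // n < N ∧ 0 ≤ x n ∧ x n < v} : ℝ) / N - v| }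

/-- An odd potential function whose derivative is `(|u| - α) / α` for `|u| ≤ α`
and `(|u| - α) / β` for `|u| ≥ α`, up to the factor `2 * α * β`. -/
noncomputable def pot (α β u : ℝ) : ℝ :=
  if u ≤ -α then -(α * (u + α) ^ 2) + β * α ^ 2
  else if u ≤ 0 then -(β * u ^ 2) - 2 * α * β * u
  else if u ≤ α then β * u ^ 2 - 2 * α * β * u
  else α * (u - α) ^ 2 - β * α ^ 2

theorem neg_le_pot {α β u : ℝ} (hα : 0 < α) (hβ : 0 < β) (hu : -α ≤ u) :
    -(β * α ^ 2) ≤ pot α β u := by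
  unfold pot
  split_ifs with h1 h2 h3
  · obtain rfl : u = -α := le_antisymm h1 hu
    nlinarith [mul_pos hβ (pow_pos hα 2)]
  · nlinarith [mul_nonneg hβ.le (mul_nonneg (neg_nonneg.2 h2) (by linarith : 0 ≤ u + 2 * α)),
      mul_pos hβ (pow_pos hα 2)]
  · nlinarith [mul_nonneg hβ.le (sq_nonneg (u - α))]
  · nlinarith [mul_nonneg hα.le (sq_nonneg (u - α))]

theorem pot_add_ge {α β : ℝ} (hα : 0 < α) (hβ : α ≤ β) (v : ℝ) {t : ℝ} (ht : 0 ≤ t) :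
    pot α β v - 2 * β * α ^ 2 ≤ pot α β (v + t) := by
  have hβ0 : 0 < β := hα.trans_le hβ
  by_cases hv : v ≤ -α
  · by_cases hw : v + t ≤ -α
    · rw [pot, pot, if_pos hv, if_pos hw]
      have : (v + t + α) ^ 2 ≤ (v + α) ^ 2 := by nlinarith
      nlinarith [mul_pos hβ0 (pow_pos hα 2)]
    · have h1 : pot α β v ≤ β * α ^ 2 := by
        rw [pot, if_pos hv]; nlinarith [sq_nonneg (v + α)]
      have h2 := neg_le_pot hα hβ0 (not_le.1 hw).le
      linarith
  · by_cases hw : v ≤ α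
    · have h1 : pot α β v ≤ β * α ^ 2 := by
        rw [pot, if_neg hv]
        split_ifs <;>
          nlinarith [mul_nonneg hβ0.le (sq_nonneg (v + α)), mul_nonneg hβ0.le (sq_nonneg (v - α)),
            mul_pos hβ0 hα]
      have h2 := neg_le_pot hα hβ0 (by linarith : -α ≤ v + t)
      linarith
    · rw [pot, pot, if_neg hv, if_neg (by linarith), if_neg (by linarith), if_neg (by linarith),
        if_neg (by linarith), if_neg (by linarith)]
      have : (v - α) ^ 2 ≤ (v + t - α) ^ 2 := by nlinarith
      nlinarith [mul_pos hβ0 (pow_pos hα 2)]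

theorem pot_neg {α β : ℝ} (hα : 0 < α) (u : ℝ) : pot α β (-u) = -pot α β u := by
  unfold pot
  split_ifs <;> first
    | ring1
    | (exfalso; linarith)
    | (obtain rfl : u = 0 := by linarith
       ring1)
    | (obtain rfl : u = α := by linarith
       ring1)
    | (obtain rfl : u = -α := by linarith
       ring1)

/-- A jump across the symmetric interval of half-length `α + β` is the cheapest one. -/
theorem pot_add_unit_ge {α β : ℝ} (hα : 0 < α) (hβ : α ≤ β) (v : ℝ) :
    pot α β v + 2 * α * β * (β - α) ≤ pot α β (v + 2 * (α + β)) := by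
  have hβ0 : 0 < β := hα.trans_le hβ
  wlog hv : -(α + β) ≤ v generalizing v
  · have := this (-v - 2 * (α + β)) (by linarith)
    rw [show -v - 2 * (α + β) + 2 * (α + β) = -v by ring, pot_neg hα,
      show -v - 2 * (α + β) = -(v + 2 * (α + β)) by ring, pot_neg hα] at this
    linarith
  rw [pot, pot, if_neg (by linarith : ¬ v + 2 * (α + β) ≤ -α),
    if_neg (by linarith : ¬ v + 2 * (α + β) ≤ 0)]
  rw [if_neg (by linarith : ¬ v + 2 * (α + β) ≤ α)]
  split_ifs with h1 h2 h3
  · nlinarith [mul_nonneg hα.le (sq_nonneg (v + α + β))]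
  · nlinarith [mul_nonneg hα.le (sq_nonneg (v + α)), mul_nonneg hβ0.le (sq_nonneg (v + α)),
      mul_pos hα hβ0, mul_nonneg hα.le (by linarith : 0 ≤ v + α),
      mul_nonneg (mul_pos hα hβ0).le (by linarith : 0 ≤ v + α)]
  · have hv0 : 0 ≤ v := (not_le.1 h2).le
    have h4 : 0 ≤ β * ((α - v) * (α + v)) :=
      mul_nonneg hβ0.le (mul_nonneg (by linarith) (by linarith))
    have h5 : 0 ≤ α * β * v := by positivity
    have h6 : 0 ≤ α * (v + α) ^ 2 := by positivity
    nlinarith [mul_pos (mul_pos hα hβ0) hβ0, mul_pos (mul_pos hα hβ0) hα]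
  · nlinarith [mul_pos hα hβ0, mul_nonneg (mul_pos hα hβ0).le (by linarith : 0 ≤ v - α),
      mul_pos (mul_pos hα hβ0) hβ0, mul_pos (mul_pos hα hβ0) hα,
      mul_nonneg hα.le (mul_nonneg hα.le (by linarith : 0 ≤ v - α))]

theorem pot_tangent {α β : ℝ} (hα : 0 < α) (hβ : α ≤ β) (u : ℝ) {δ : ℝ} (hδ : 0 ≤ δ) :
    pot α β u - 2 * (if |u| ≤ α then β else α) * (|u| - α) * δ - β * δ ^ 2 ≤
      pot α β (u - δ) := by
  have hβ0 : 0 < β := hα.trans_le hβ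
  obtain ⟨γ, rfl⟩ : ∃ γ, β = α + γ := ⟨β - α, by ring⟩
  have hγ : 0 ≤ γ := by linarith
  have hD : 0 ≤ γ * δ ^ 2 := by positivity
  have hA : 0 ≤ α * δ ^ 2 := by positivity
  have hW : 0 ≤ γ * (u - δ + α) ^ 2 := by positivity
  rcases le_total u 0 with hu | hu
  · rw [abs_of_nonpos hu]
    by_cases h1 : -u ≤ α
    · rw [if_pos h1]
      unfold pot
      split_ifs with h2 h3 <;> try (exfalso; linarith)
      · obtain rfl : u = -α := by linarith
        nlinarith
      · nlinarith
      · nlinarith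
    · rw [if_neg h1]
      unfold pot
      split_ifs <;> try (exfalso; linarith)
      nlinarith
  · rw [abs_of_nonneg hu]
    by_cases h1 : u ≤ α
    · rw [if_pos h1]
      unfold pot
      split_ifs with h2 h3 h4 h5 <;> try (exfalso; linarith)
      · obtain rfl : u = 0 := by linarith
        nlinarith
      · obtain rfl : u = 0 := by linarith
        nlinarith
      · nlinarith [mul_nonneg hβ0.le (mul_nonneg hu (by linarith : 0 ≤ 2 * δ - u))]
      · nlinarith [mul_nonneg hβ0.le (mul_nonneg hu (by linarith : 0 ≤ 2 * δ - u))]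
      · nlinarith
    · rw [if_neg h1]
      have hR : 0 ≤ γ * (δ - (u - α)) ^ 2 := by positivity
      have hR' : 0 ≤ γ * (u - α) ^ 2 := by positivity
      have hT : 0 ≤ γ * (δ * α) := by positivity
      unfold pot
      split_ifs <;> try (exfalso; linarith)
      · nlinarith [mul_nonneg hα.le (mul_nonneg hu (by linarith : 0 ≤ 2 * δ - u)),
          mul_nonneg hγ (mul_nonneg hu (by linarith : 0 ≤ δ - u))]
      · nlinarith [mul_nonneg hα.le (mul_nonneg hu (by linarith : 0 ≤ 2 * δ - u)),
          mul_nonneg hγ (mul_nonneg hu (by linarith : 0 ≤ δ - u))]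
      · nlinarith
      · nlinarith

/-- Sliding down at a rate between `α` and `β`. -/
theorem pot_sub_ge {α β : ℝ} (hα : 0 < α) (hβ : α ≤ β) (u : ℝ) {ε σ : ℝ} (hε : 0 ≤ ε)
    (hσ : α ≤ σ) (hσ' : σ ≤ β) :
    pot α β u - 2 * α * β * ε * (|u| - α) - β * (ε * β) ^ 2 ≤ pot α β (u - ε * σ) := by
  have hβ0 : 0 < β := hα.trans_le hβ
  have hσ0 : 0 ≤ σ := hα.le.trans hσ
  refine le_trans ?_ (pot_tangent hα hβ u (mul_nonneg hε hσ0))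
  have h1 : β * (ε * σ) ^ 2 ≤ β * (ε * β) ^ 2 := by gcongr
  split_ifs with h
  · nlinarith [mul_nonneg (mul_nonneg hβ0.le hε)
      (mul_nonneg (sub_nonneg.2 h) (sub_nonneg.2 hσ))]
  · nlinarith [mul_nonneg (mul_nonneg hα.le hε)
      (mul_nonneg (sub_nonneg.2 (not_le.1 h).le) (sub_nonneg.2 hσ'))]

/-- A jump that contains `p` full units and at most `q` further ones. -/
theorem pot_jump_ge {α β : ℝ} (hα : 0 < α) (hβ : α ≤ β) (v : ℝ) (p q : ℕ) {e : ℝ}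
    (he : p ≤ e) (he' : e ≤ p + q) :
    pot α β v + p * (2 * α * β * (β - α)) - q * (2 * β * α ^ 2) ≤
      pot α β (v + 2 * (α + β) * e) := by
  have hβ0 : 0 < β := hα.trans_le hβ
  induction p generalizing v e with
  | zero =>
    rcases Nat.eq_zero_or_pos q with rfl | hq
    · obtain rfl : e = 0 := le_antisymm (by simpa using he') (by simpa using he)
      simp
    · have h1 := pot_add_ge hα hβ v (t := 2 * (α + β) * e)
        (mul_nonneg (by positivity) (by simpa using he))
      have h2 : (1 : ℝ) ≤ q := by exact_mod_cast hq
      have h3 : 0 ≤ 2 * β * α ^ 2 := by positivity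
      push_cast
      nlinarith
  | succ p ih =>
    push_cast at he he' ⊢
    have h1 := ih (v + 2 * (α + β)) (e := e - 1) (by linarith) (by linarith)
    have h2 := pot_add_unit_ge hα hβ v
    rw [show v + 2 * (α + β) + 2 * (α + β) * (e - 1) = v + 2 * (α + β) * e by ring] at h1
    linarith

/-- A sampled closed path that slides down at a rate between `α` and `β`, with `α` unit jumps
and `β - α` jumps of height between `0` and `1`, has mean absolute value at least
`α / (2 * (α + β))`, up to an error from sampling. -/
theorem sum_abs_path_ge {α β : ℝ} (hα : 0 < α) (hβ : α ≤ β) {L : ℕ} (hL : 0 < L)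
    (f : ℕ → ℝ) (p q : ℕ → ℕ) (f_zero : f 0 = 0) (f_last : f L = 0)
    (hp : ∑ j ∈ Finset.range L, (p j : ℝ) = α) (hq : ∑ j ∈ Finset.range L, (q j : ℝ) = β - α)
    (hlow : ∀ j < L, f j + p j - β / L ≤ f (j + 1))
    (hupp : ∀ j < L, f (j + 1) ≤ f j + p j + q j - α / L) :
    α / (2 * (α + β)) * L - β ^ 2 / (2 * α) ≤ ∑ j ∈ Finset.range L, |f j| := by
  have hβ0 : 0 < β := hα.trans_le hβ
  have hL0 : (0 : ℝ) < L := by exact_mod_cast hL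
  set s := 2 * (α + β) with hs
  have hs0 : 0 < s := by positivity
  set ε := s / L with hε
  have hε0 : 0 < ε := by positivity
  have step : ∀ j ∈ Finset.range L,
      p j * (2 * α * β * (β - α)) - q j * (2 * β * α ^ 2)
        - 2 * α * β * ε * (s * |f j| - α) - β * (ε * β) ^ 2 ≤
      pot α β (s * f (j + 1)) - pot α β (s * f j) := by
    intro j hj
    have hj := Finset.mem_range.1 hj
    obtain ⟨σ, e, h1, h2, h3, h4, h5⟩ : ∃ σ e : ℝ, α ≤ σ ∧ σ ≤ β ∧ p j ≤ e ∧
        e ≤ p j + q j ∧ f (j + 1) = f j - σ / L + e := by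
      have hlow := hlow j hj
      have hupp := hupp j hj
      by_cases h : f (j + 1) ≤ f j + p j - α / L
      · refine ⟨(f j + p j - f (j + 1)) * L, p j, ?_, ?_, le_rfl, by simp, by field_simp; ring⟩
        · rw [← div_le_iff₀ hL0]; linarith
        · rw [← le_div_iff₀ hL0]; linarith
      · exact ⟨α, f (j + 1) - f j + α / L, le_rfl, hβ, by linarith, by linarith, by ring⟩
    have hslide := pot_sub_ge hα hβ (s * f j) hε0.le h1 h2
    have hjump := pot_jump_ge hα hβ (s * f j - ε * σ) (p j) (q j) h3 h4
    rw [abs_mul, abs_of_pos hs0] at hslide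
    rw [← hs, show s * f j - ε * σ + s * e = s * f (j + 1) by rw [h5, hε]; ring] at hjump
    linarith
  have hsum := Finset.sum_le_sum step
  rw [Finset.sum_range_sub (fun j => pot α β (s * f j)), f_zero, f_last, sub_self] at hsum
  simp only [Finset.sum_sub_distrib, ← Finset.sum_mul, ← Finset.mul_sum, hp, hq,
    Finset.sum_const, Finset.card_range, nsmul_eq_mul] at hsum
  set S := ∑ j ∈ Finset.range L, |f j|
  have hεL : ε * L = s := by rw [hε]; field_simp
  have key : 2 * α * β * ε * (L * α - s * S) ≤ 2 * α * β * ε * (s * (β ^ 2 / (2 * α))) := by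
    have : 2 * α * β * ε * (s * (β ^ 2 / (2 * α))) = L * (β * (ε * β) ^ 2) := by
      rw [← hεL]; field_simp
    rw [this]
    linarith
  have key := le_of_mul_le_mul_left key (by positivity)
  have : s * (α / s * L - β ^ 2 / (2 * α)) ≤ s * S := by
    rw [mul_sub, ← mul_assoc, mul_div_cancel₀ _ hs0.ne']
    linarith
  exact le_of_mul_le_mul_left this hs0

/-- The unnormalized local discrepancy of the first `n` points of `x` on `[0,v)`. -/
noncomputable def localDisc (x : ℕ → ℝ) (n : ℕ) (v : ℝ) : ℝ :=
  ((Finset.range n).filter (fun i => x i < v)).card - n * v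

theorem localDisc_add (x : ℕ → ℝ) (a n : ℕ) (v : ℝ) :
    localDisc x (a + n) v = localDisc x a v + localDisc (fun i => x (a + i)) n v := by
  have : ((Finset.range (a + n)).filter (fun i => x i < v)).card =
      ((Finset.range a).filter (fun i => x i < v)).card +
        ((Finset.range n).filter (fun i => x (a + i) < v)).card := by
    simp only [Finset.card_filter, Finset.sum_range_add]
  unfold localDisc
  rw [this]
  push_cast
  ring

theorem localDisc_zero_right {x : ℕ → ℝ} (hx : ∀ n, x n ∈ Set.Ico (0 : ℝ) 1) (n : ℕ) :
    localDisc x n 0 = 0 := by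
  have : (Finset.range n).filter (fun i => x i < 0) = ∅ :=
    Finset.filter_eq_empty_iff.2 fun i _ => not_lt.2 (hx i).1
  simp [localDisc, this]

theorem localDisc_one_right {x : ℕ → ℝ} (hx : ∀ n, x n ∈ Set.Ico (0 : ℝ) 1) (n : ℕ) :
    localDisc x n 1 = 0 := by
  have : (Finset.range n).filter (fun i => x i < 1) = Finset.range n :=
    Finset.filter_true_of_mem fun i _ => (hx i).2
  simp [localDisc, this]

/-- The number of the first `n` points of `x` in the `j`-th of the cells of length `1 / L`. -/
noncomputable def cellCount (x : ℕ → ℝ) (L n j : ℕ) : ℕ :=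
  ((Finset.range n).filter (fun i => (j / L : ℝ) ≤ x i ∧ x i < ((j + 1 : ℕ) : ℝ) / L)).card

theorem cellCount_mono (x : ℕ → ℝ) (L j : ℕ) : Monotone fun n => cellCount x L n j :=
  fun _ _ h => Finset.card_le_card
    (Finset.filter_subset_filter _ (Finset.range_subset_range.2 h))

theorem localDisc_succ_div (x : ℕ → ℝ) (L n j : ℕ) :
    localDisc x n (((j + 1 : ℕ) : ℝ) / L) =
      localDisc x n (j / L) + cellCount x L n j - n / L := by
  have h : (j / L : ℝ) ≤ ((j + 1 : ℕ) : ℝ) / L := by gcongr; simp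
  have : ((Finset.range n).filter (fun i => x i < ((j + 1 : ℕ) : ℝ) / L)).card =
      ((Finset.range n).filter (fun i => x i < (j / L : ℝ))).card + cellCount x L n j := by
    rw [cellCount, ← Finset.card_union_of_disjoint]
    · congr 1
      ext i
      simp only [Finset.mem_union, Finset.mem_filter]
      constructor
      · rintro ⟨h1, h2⟩
        rcases lt_or_ge (x i) (j / L : ℝ) with h3 | h3
        · exact Or.inl ⟨h1, h3⟩
        · exact Or.inr ⟨h1, h3, h2⟩
      · rintro (⟨h1, h2⟩ | ⟨h1, -, h2⟩)
        · exact ⟨h1, h2.trans_le h⟩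
        · exact ⟨h1, h2⟩
    · rw [Finset.disjoint_filter]
      intro i _ h1 h2
      exact absurd h1 (not_lt.2 h2.1)
  unfold localDisc
  rw [this]
  push_cast
  ring

theorem sum_cellCount {x : ℕ → ℝ} (hx : ∀ n, x n ∈ Set.Ico (0 : ℝ) 1) {L : ℕ} (hL : 0 < L)
    (n : ℕ) : ∑ j ∈ Finset.range L, (cellCount x L n j : ℝ) = n := by
  have hL0 : (L : ℝ) ≠ 0 := by exact_mod_cast hL.ne'
  have h1 := Finset.sum_range_sub (fun j : ℕ => localDisc x n ((j : ℝ) / L)) L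
  simp only [localDisc_succ_div] at h1
  rw [div_self hL0, Nat.cast_zero, zero_div, localDisc_zero_right hx, localDisc_one_right hx] at h1
  have h2 : ∀ j ∈ Finset.range L, localDisc x n ((j : ℝ) / L) + cellCount x L n j - n / L
      - localDisc x n ((j : ℝ) / L) = cellCount x L n j - n / L := fun j _ => by ring
  rw [Finset.sum_congr rfl h2, Finset.sum_sub_distrib, Finset.sum_const, Finset.card_range,
    nsmul_eq_mul, mul_div_cancel₀ _ hL0] at h1
  linarith

/-- The lower bound for the difference of a monotone, translation equivariant statistic `Φ`
(such as the maximum) over the first `M` and the last `M` indices. -/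
theorem sum_abs_diff_ge {x : ℕ → ℝ} (hx : ∀ n, x n ∈ Set.Ico (0 : ℝ) 1) {K M L : ℕ}
    (hK : 0 < K) (hL : 0 < L) (Φ : (ℕ → ℝ) → ℝ)
    (hΦ : ∀ (D D' : ℕ → ℝ) (c : ℝ), (∀ n ≤ M, D n + c ≤ D' n) → Φ D + c ≤ Φ D') :
    (K / (4 * (K + M)) : ℝ) * L - (K + 2 * M) ^ 2 / (2 * K) ≤
      ∑ j ∈ Finset.range L, |Φ (fun n => localDisc x (K + M + n) (j / L)) -
        Φ (fun n => localDisc x n (j / L))| := by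
  have hK0 : (0 : ℝ) < K := by exact_mod_cast hK
  have hL0 : (L : ℝ) ≠ 0 := by exact_mod_cast hL.ne'
  have hmono : ∀ {a b : ℕ} (j : ℕ), a ≤ b → (cellCount x L a j : ℝ) ≤ cellCount x L b j :=
    fun j h => by exact_mod_cast cellCount_mono x L j h
  have hp : ∀ j, ((cellCount x L (K + M) j - cellCount x L M j : ℕ) : ℝ) =
      cellCount x L (K + M) j - cellCount x L M j := fun j =>
    Nat.cast_sub (cellCount_mono x L j (by omega))
  have hq : ∀ j, ((cellCount x L (K + 2 * M) j - cellCount x L (K + M) j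
      + cellCount x L M j : ℕ) : ℝ) =
      cellCount x L (K + 2 * M) j - cellCount x L (K + M) j + cellCount x L M j := fun j => by
    rw [Nat.cast_add, Nat.cast_sub (cellCount_mono x L j (by omega))]
  have hdiv : ∀ {a b : ℝ}, a ≤ b → a / L ≤ b / L := fun h => by gcongr
  have main := sum_abs_path_ge (α := K) (β := K + 2 * M) hK0 (by simp) hL
    (fun j => Φ (fun n => localDisc x (K + M + n) (j / L)) - Φ (fun n => localDisc x n (j / L)))
    (fun j => cellCount x L (K + M) j - cellCount x L M j)
    (fun j => cellCount x L (K + 2 * M) j - cellCount x L (K + M) j + cellCount x L M j)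
    (by simp [localDisc_zero_right hx]) (by simp [div_self hL0, localDisc_one_right hx])
    (by simp only [hp, Finset.sum_sub_distrib, sum_cellCount hx hL]; push_cast; ring)
    (by simp only [hq, Finset.sum_sub_distrib, Finset.sum_add_distrib, sum_cellCount hx hL]
        push_cast; ring)
    (by
      intro j _
      rw [hp]
      have h1 := hΦ (fun n => localDisc x (K + M + n) (j / L))
        (fun n => localDisc x (K + M + n) (((j + 1 : ℕ) : ℝ) / L))
        (cellCount x L (K + M) j - (K + 2 * M : ℝ) / L) (by
          intro n hn
          rw [localDisc_succ_div]
          have h2 := hmono j (show K + M ≤ K + M + n by omega)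
          have h3 := hdiv (show ((K + M + n : ℕ) : ℝ) ≤ K + 2 * M by
            exact_mod_cast (by omega : K + M + n ≤ K + 2 * M))
          linarith)
      have h4 := hΦ (fun n => localDisc x n (((j + 1 : ℕ) : ℝ) / L))
        (fun n => localDisc x n (j / L)) (-(cellCount x L M j : ℝ)) (by
          intro n hn
          rw [localDisc_succ_div]
          have h2 := hmono j hn
          have h3 : (0 : ℝ) ≤ n / L := by positivity
          linarith)
      linarith)
    (by
      intro j _
      rw [hp, hq]
      have h1 := hΦ (fun n => localDisc x (K + M + n) (((j + 1 : ℕ) : ℝ) / L))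
        (fun n => localDisc x (K + M + n) (j / L))
        ((K + M : ℝ) / L - cellCount x L (K + 2 * M) j) (by
          intro n hn
          rw [localDisc_succ_div]
          have h2 := hmono j (show K + M + n ≤ K + 2 * M by omega)
          have h3 := hdiv (show (K + M : ℝ) ≤ ((K + M + n : ℕ) : ℝ) by
            exact_mod_cast (by omega : K + M ≤ K + M + n))
          linarith)
      have h4 := hΦ (fun n => localDisc x n (j / L))
        (fun n => localDisc x n (((j + 1 : ℕ) : ℝ) / L)) (-(M / L : ℝ)) (by
          intro n hn
          rw [localDisc_succ_div]
          have h2 : (0 : ℝ) ≤ cellCount x L n j := by positivity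
          have h3 := hdiv (show (n : ℝ) ≤ M by exact_mod_cast hn)
          linarith)
      have h5 : (K + M : ℝ) / L = K / L + M / L := by ring
      linarith)
  rwa [show (2 * (K + (K + 2 * M)) : ℝ) = 4 * (K + M) by ring] at main

/-- The oscillation of the local discrepancy at `v` over the indices `0, …, n`. -/
noncomputable def discOsc (x : ℕ → ℝ) (n : ℕ) (v : ℝ) : ℝ :=
  (Finset.range (n + 1)).sup' Finset.nonempty_range_add_one (fun k => localDisc x k v) -
    (Finset.range (n + 1)).inf' Finset.nonempty_range_add_one (fun k => localDisc x k v)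

theorem sup'_range_add_le (M : ℕ) (D D' : ℕ → ℝ) (c : ℝ) (h : ∀ n ≤ M, D n + c ≤ D' n) :
    (Finset.range (M + 1)).sup' Finset.nonempty_range_add_one D + c ≤
      (Finset.range (M + 1)).sup' Finset.nonempty_range_add_one D' := by
  rw [← le_sub_iff_add_le]
  refine Finset.sup'_le _ _ fun n hn => ?_
  rw [le_sub_iff_add_le]
  exact (h n (Finset.mem_range_succ_iff.1 hn)).trans (Finset.le_sup' D' hn)

theorem inf'_range_add_le (M : ℕ) (D D' : ℕ → ℝ) (c : ℝ) (h : ∀ n ≤ M, D n + c ≤ D' n) :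
    (Finset.range (M + 1)).inf' Finset.nonempty_range_add_one D + c ≤
      (Finset.range (M + 1)).inf' Finset.nonempty_range_add_one D' := by
  refine Finset.le_inf' _ _ fun n hn => ?_
  exact (add_le_add_left (Finset.inf'_le D hn) c).trans (h n (Finset.mem_range_succ_iff.1 hn))

theorem discOsc_ge (x : ℕ → ℝ) (K M : ℕ) (v : ℝ) :
    discOsc x M v + discOsc (fun i => x (K + M + i)) M v +
      |(Finset.range (M + 1)).sup' Finset.nonempty_range_add_one
          (fun n => localDisc x (K + M + n) v) -
        (Finset.range (M + 1)).sup' Finset.nonempty_range_add_one (fun n => localDisc x n v)| +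
      |(Finset.range (M + 1)).inf' Finset.nonempty_range_add_one
          (fun n => localDisc x (K + M + n) v) -
        (Finset.range (M + 1)).inf' Finset.nonempty_range_add_one (fun n => localDisc x n v)| ≤
      2 * discOsc x (K + 2 * M) v := by
  have h1 := sup'_range_add_le M (fun n => localDisc (fun i => x (K + M + i)) n v)
    (fun n => localDisc x (K + M + n) v) (localDisc x (K + M) v)
    (fun n _ => by rw [localDisc_add x (K + M)]; linarith)
  have h2 := inf'_range_add_le M (fun n => localDisc x (K + M + n) v)
    (fun n => localDisc (fun i => x (K + M + i)) n v) (-localDisc x (K + M) v)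
    (fun n _ => by rw [localDisc_add x (K + M)]; linarith)
  have h3 : (Finset.range (M + 1)).sup' Finset.nonempty_range_add_one
      (fun n => localDisc x n v) ≤ (Finset.range (K + 2 * M + 1)).sup'
        Finset.nonempty_range_add_one (fun n => localDisc x n v) :=
    Finset.sup'_mono _ (Finset.range_subset_range.2 (by omega)) _
  have h4 : (Finset.range (M + 1)).sup' Finset.nonempty_range_add_one
      (fun n => localDisc x (K + M + n) v) ≤ (Finset.range (K + 2 * M + 1)).sup'
        Finset.nonempty_range_add_one (fun n => localDisc x n v) :=
    Finset.sup'_le _ _ fun n hn => Finset.le_sup' (fun n => localDisc x n v)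
      (Finset.mem_range.2 (by have := Finset.mem_range.1 hn; omega))
  have h5 : (Finset.range (K + 2 * M + 1)).inf' Finset.nonempty_range_add_one
      (fun n => localDisc x n v) ≤ (Finset.range (M + 1)).inf'
        Finset.nonempty_range_add_one (fun n => localDisc x n v) :=
    Finset.inf'_mono _ (Finset.range_subset_range.2 (by omega)) _
  have h6 : (Finset.range (K + 2 * M + 1)).inf' Finset.nonempty_range_add_one
      (fun n => localDisc x n v) ≤ (Finset.range (M + 1)).inf'
        Finset.nonempty_range_add_one (fun n => localDisc x (K + M + n) v) :=
    Finset.le_inf' _ _ fun n hn => Finset.inf'_le (fun n => localDisc x n v)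
      (Finset.mem_range.2 (by have := Finset.mem_range.1 hn; omega))
  unfold discOsc
  rcases abs_cases ((Finset.range (M + 1)).sup' Finset.nonempty_range_add_one
          (fun n => localDisc x (K + M + n) v) -
        (Finset.range (M + 1)).sup' Finset.nonempty_range_add_one
          (fun n => localDisc x n v)) with ⟨e1, -⟩ | ⟨e1, -⟩ <;>
  rcases abs_cases ((Finset.range (M + 1)).inf' Finset.nonempty_range_add_one
          (fun n => localDisc x (K + M + n) v) -
        (Finset.range (M + 1)).inf' Finset.nonempty_range_add_one
          (fun n => localDisc x n v)) with ⟨e2, -⟩ | ⟨e2, -⟩ <;>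
  · rw [e1, e2]; linarith

/-- Lengths growing by the factor `15 / 4`, rounded up. -/
def blockLength : ℕ → ℕ
  | 0 => 1
  | t + 1 => (15 * blockLength t + 3) / 4

theorem blockLength_pos (t : ℕ) : 0 < blockLength t := by
  induction t with
  | zero => simp [blockLength]
  | succ t ih => rw [blockLength]; omega

theorem blockLength_le (t : ℕ) : (blockLength t : ℝ) ≤ 2 * (15 / 4) ^ t := by
  suffices h : (blockLength t : ℝ) + 1 ≤ 2 * (15 / 4) ^ t by linarith
  induction t with
  | zero => norm_num [blockLength]
  | succ t ih =>
    have : 4 * blockLength (t + 1) ≤ 15 * blockLength t + 3 := by rw [blockLength]; omega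
    have : (4 * blockLength (t + 1) : ℝ) ≤ 15 * blockLength t + 3 := by exact_mod_cast this
    rw [pow_succ]
    linarith

theorem sum_discOsc_ge (t : ℕ) : ∃ C : ℝ, ∀ x : ℕ → ℝ, (∀ n, x n ∈ Set.Ico (0 : ℝ) 1) →
    ∀ L : ℕ, 0 < L →
      7 / 44 * t * L - C ≤ ∑ j ∈ Finset.range L, discOsc x (blockLength t) (j / L) := by
  induction t with
  | zero =>
    refine ⟨0, fun x _ L _ => ?_⟩
    simp only [Nat.cast_zero, mul_zero, zero_mul, sub_zero]
    refine Finset.sum_nonneg fun j _ => ?_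
    have h0 : (0 : ℕ) ∈ Finset.range (blockLength 0 + 1) := by simp
    exact sub_nonneg.2 ((Finset.inf'_le _ h0).trans
      (Finset.le_sup' (fun k => localDisc x k (j / L)) h0))
  | succ t ih =>
    obtain ⟨C, hC⟩ := ih
    set M := blockLength t with hM
    have hM0 : 0 < M := blockLength_pos t
    obtain ⟨K, hK⟩ : ∃ K, blockLength (t + 1) = K + 2 * M :=
      ⟨blockLength (t + 1) - 2 * M, by rw [blockLength]; omega⟩
    have hKM : 7 * M ≤ 4 * K := by rw [blockLength] at hK; omega
    have hK0 : 0 < K := by omega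
    refine ⟨C + (K + 2 * M) ^ 2 / (2 * K), fun x hx L hL => ?_⟩
    rw [hK]
    have h1 := hC x hx L hL
    have h2 := hC (fun i => x (K + M + i)) (fun n => hx _) L hL
    have h3 := sum_abs_diff_ge hx hK0 hL _ (sup'_range_add_le M)
    have h4 := sum_abs_diff_ge hx hK0 hL _ (inf'_range_add_le M)
    have h5 := Finset.sum_le_sum fun (j : ℕ) (_ : j ∈ Finset.range L) =>
      discOsc_ge x K M (j / L)
    simp only [Finset.sum_add_distrib, ← Finset.mul_sum] at h5
    have h6 : (7 / 44 : ℝ) ≤ K / (4 * (K + M)) := by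
      have : (7 * M : ℝ) ≤ 4 * K := by exact_mod_cast hKM
      rw [div_le_div_iff₀ (by norm_num) (by positivity)]
      linarith
    have h7 : (7 / 44 : ℝ) * L ≤ K / (4 * (K + M)) * L := by gcongr
    push_cast
    linarith

theorem abs_localDisc_le {x : ℕ → ℝ} (n : ℕ) {v : ℝ} (hv : v ∈ Set.Icc (0 : ℝ) 1) :
    |localDisc x n v| ≤ n := by
  have h1 : (((Finset.range n).filter (fun i => x i < v)).card : ℝ) ≤ n := by
    exact_mod_cast (Finset.card_filter_le _ _).trans (Finset.card_range n).le
  have h2 : (0 : ℝ) ≤ ((Finset.range n).filter (fun i => x i < v)).card := by positivity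
  have h3 : (0 : ℝ) ≤ n := by positivity
  rw [localDisc, abs_le]
  constructor <;> nlinarith [hv.1, hv.2]

theorem abs_localDisc_le_starDisc1 {x : ℕ → ℝ} (hx : ∀ n, x n ∈ Set.Ico (0 : ℝ) 1) {n : ℕ}
    (hn : 0 < n) {v : ℝ} (hv : 0 < v) (hv1 : v ≤ 1) :
    |localDisc x n v| / n ≤ starDisc1 x n := by
  have hn0 : (0 : ℝ) < n := by exact_mod_cast hn
  have key : ∀ w : ℝ, |(Nat.card {k : ℕ // k < n ∧ 0 ≤ x k ∧ x k < w} : ℝ) / n - w| =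
      |localDisc x n w| / n := by
    intro w
    have : Nat.card {k : ℕ // k < n ∧ 0 ≤ x k ∧ x k < w} =
        ((Finset.range n).filter (fun i => x i < w)).card := by
      refine Nat.subtype_card _ fun k => ?_
      simp [(hx k).1]
    rw [this, ← abs_of_pos hn0, ← abs_div, abs_of_pos hn0, localDisc]
    congr 1
    field_simp
  refine le_csSup ⟨1, ?_⟩ ⟨v, hv, hv1, (key v).symm⟩
  rintro r ⟨w, hw, hw1, rfl⟩
  rw [key, div_le_one hn0]
  exact abs_localDisc_le n ⟨hw.le, hw1⟩

theorem exists_large_localDisc {x : ℕ → ℝ} (hx : ∀ n, x n ∈ Set.Ico (0 : ℝ) 1) (t : ℕ) :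
    ∃ n ≤ blockLength t, ∃ v ∈ Set.Icc (0 : ℝ) 1,
      7 / 88 * t - 1 / 2 ≤ |localDisc x n v| := by
  obtain ⟨C, hC⟩ := sum_discOsc_ge t
  obtain ⟨L, hL⟩ := exists_nat_ge (max C 1)
  have hL1 : (1 : ℝ) ≤ L := (le_max_right _ _).trans hL
  have hL0 : 0 < L := by exact_mod_cast zero_lt_one.trans_le hL1
  have hsum : ∑ j ∈ Finset.range L, (7 / 44 * t - 1 : ℝ) ≤
      ∑ j ∈ Finset.range L, discOsc x (blockLength t) (j / L) := by
    refine le_trans ?_ (hC x hx L hL0)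
    rw [Finset.sum_const, Finset.card_range, nsmul_eq_mul]
    linarith [(le_max_left C 1).trans hL]
  obtain ⟨j, hj, hosc⟩ :=
    Finset.exists_le_of_sum_le (Finset.nonempty_range_iff.2 hL0.ne') hsum
  have hv : (j / L : ℝ) ∈ Set.Icc (0 : ℝ) 1 := by
    refine ⟨by positivity, div_le_one_of_le₀ ?_ (by positivity)⟩
    exact_mod_cast (Finset.mem_range.1 hj).le
  obtain ⟨a, ha, hsup⟩ := Finset.exists_mem_eq_sup' Finset.nonempty_range_add_one
    (s := Finset.range (blockLength t + 1)) (fun k => localDisc x k (j / L))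
  obtain ⟨b, hb, hinf⟩ := Finset.exists_mem_eq_inf' Finset.nonempty_range_add_one
    (s := Finset.range (blockLength t + 1)) (fun k => localDisc x k (j / L))
  rw [discOsc, hsup, hinf] at hosc
  by_cases h : 7 / 88 * t - 1 / 2 ≤ |localDisc x a (j / L)|
  · exact ⟨a, Finset.mem_range_succ_iff.1 ha, _, hv, h⟩
  · refine ⟨b, Finset.mem_range_succ_iff.1 hb, _, hv, ?_⟩
    have h1 := le_abs_self (localDisc x a (j / L))
    have h2 := neg_le_abs (localDisc x b (j / L))
    linarith

theorem log_fifteen_div_four_le : Real.log (15 / 4) ≤ 82 / 43 * Real.log 2 := by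
  have h : Real.log ((15 / 4) ^ 43) ≤ Real.log (2 ^ 82) :=
    Real.log_le_log (by positivity) (by norm_num)
  rw [Real.log_pow, Real.log_pow] at h
  push_cast at h
  linarith

theorem log_le_of_le_blockLength {n t : ℕ} (hn : 0 < n) (h : n ≤ blockLength t) :
    Real.log n ≤ Real.log 2 * (1 + 82 / 43 * t) := by
  have hn0 : (0 : ℝ) < n := by exact_mod_cast hn
  have h1 : (n : ℝ) ≤ 2 * (15 / 4) ^ t := le_trans (by exact_mod_cast h) (blockLength_le t)
  have h2 := Real.log_le_log hn0 h1
  rw [Real.log_mul (by norm_num) (by positivity), Real.log_pow] at h2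
  have h3 : t * Real.log (15 / 4) ≤ t * (82 / 43 * Real.log 2) := by
    gcongr
    exact log_fifteen_div_four_le
  linarith

theorem stmt11 (x : ℕ → ℝ) (hx : ∀ n, x n ∈ Set.Ico (0 : ℝ) 1) :
    ∀ m : ℕ, ∃ N : ℕ, m ≤ N ∧
      0.06015 * Real.log N / N ≤ starDisc1 x N := by
  intro m
  obtain ⟨n, hn, v, hv, hd⟩ := exists_large_localDisc hx (100000 + 100 * m)
  have hm : (0 : ℝ) ≤ m := by positivity
  push_cast at hd
  have hle := abs_localDisc_le (x := x) n hv
  have hmn : (m : ℝ) ≤ n := by linarith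
  have hn0 : (0 : ℝ) < n := by linarith
  have hn1 : 0 < n := by exact_mod_cast hn0
  have hv0 : 0 < v := by
    rcases hv.1.lt_or_eq with h | rfl
    · exact h
    · rw [localDisc_zero_right hx, abs_zero] at hd
      linarith
  refine ⟨n, by exact_mod_cast hmn, le_trans ?_ (abs_localDisc_le_starDisc1 hx hn1 hv0 hv.2)⟩
  have hlog := log_le_of_le_blockLength hn1 hn
  push_cast at hlog
  have h2 : Real.log 2 * (1 + 82 / 43 * (100000 + 100 * m)) ≤
      0.6931471808 * (1 + 82 / 43 * (100000 + 100 * m)) := by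
    gcongr
    exact Real.log_two_lt_d9.le
  gcongr
  linarith
end

section
/- There exists a sequence (x_n)_{n≥0} in [0,1) and an N_0 ∈ ℕ such that its star discrepancy satisfies D_N* ≤ 0.223 · (log N) / N for all N ≥ N_0. -/
open Real

/-- Ostromoukhov's permutation of `{0, …, 59}`, as a list of values. -/
def permTable : List ℕ :=
  [0, 15, 30, 40, 2, 48, 20, 35, 8, 52, 23, 43, 12, 26, 55, 4, 32, 45, 17, 37, 6, 50, 28, 10, 57,
    21, 41, 13, 33, 54, 1, 25, 46, 18, 38, 5, 49, 29, 9, 58, 22, 42, 14, 34, 53, 3, 27, 47, 16, 36,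
    7, 51, 19, 44, 31, 11, 56, 24, 39, 59]

/-- Ostromoukhov's permutation of `{0, …, 59}`. -/
def perm (a : ℕ) : ℕ := permTable.getD a 0

/-- The permutation acting on the `n`-th digit: `perm` and its reflection `59 - perm`, alternating
in blocks of fifty positions. -/
def digitPerm (n a : ℕ) : ℕ := if n / 50 % 2 = 0 then perm a else 59 - perm a

/-- The first `n` base-60 digits of `i`, permuted and read in reverse order. -/
def rev : ℕ → ℕ → ℕ
  | 0, _ => 0
  | n + 1, i => 60 * rev n i + digitPerm n (i / 60 ^ n % 60)

/-! ### Numerical properties of the permutation -/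

/-- The inequalities between the counts `c`, `c'` of values below `h` among the first `k` and the
first `k + 1` entries of the permutation. -/
def CountBounds (h k c c' : ℕ) : Prop :=
  h * k ≤ 60 * c ∧ h * (k + 1) ≤ 60 * c' ∧
  6000 * c + 23 * k ≤ 12300 + 100 * h * k ∧
  6000 * c ≤ 10920 + 23 * k + 100 * h * k ∧
  6000 * c' + 23 * (k + 1) ≤ 12300 + 100 * h * (k + 1) ∧
  6000 * c' ≤ 10920 + 23 * (k + 1) + 100 * h * (k + 1) ∧
  6000 * (c + c') + 46 * k ≤ 23197 + 100 * h * (2 * k + 1) ∧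
  6000 * (c + c') ≤ 20483 + 46 * k + 100 * h * (2 * k + 1)

instance (h k c c' : ℕ) : Decidable (CountBounds h k c c') := by
  unfold CountBounds; infer_instance

/-- Checks `CountBounds` along a list, starting from position `k` and count `c`, and checks that
the final count is `h`. -/
def checkCounts (h : ℕ) : List ℕ → ℕ → ℕ → Bool
  | [], _, c => decide (c = h)
  | a :: l, k, c =>
    decide (CountBounds h k c (c + if a < h then 1 else 0)) &&
      checkCounts h l (k + 1) (c + if a < h then 1 else 0)

theorem checkCounts_sound (h : ℕ) (l : List ℕ) (k c : ℕ) (H : checkCounts h l k c = true) :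
    (∀ i < l.length, CountBounds h (k + i) (c + Nat.count (fun a => l.getD a 0 < h) i)
      (c + Nat.count (fun a => l.getD a 0 < h) (i + 1))) ∧
    c + Nat.count (fun a => l.getD a 0 < h) l.length = h := by
  induction l generalizing k c with
  | nil => simpa [checkCounts] using H
  | cons a l ih =>
    simp only [checkCounts, Bool.and_eq_true, decide_eq_true_eq] at H
    obtain ⟨h1, h2⟩ := ih _ _ H.2
    have key : ∀ i, c + Nat.count (fun b => (a :: l).getD b 0 < h) (i + 1) =
        c + (if a < h then 1 else 0) + Nat.count (fun b => l.getD b 0 < h) i := by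
      intro i
      rw [Nat.count_succ']
      simp only [List.getD_cons_succ, List.getD_cons_zero]
      omega
    refine ⟨?_, ?_⟩
    · rintro (_ | i) hi
      · rw [key]; simpa using H.1
      · rw [key, key, show k + (i + 1) = k + 1 + i by ring]
        exact h1 i (by simpa using hi)
    · rw [List.length_cons, key]; exact h2

theorem checkCounts_permTable : ∀ h < 61, checkCounts h permTable 0 0 = true := by
  decide +kernel

theorem perm_countBounds {h k : ℕ} (hh : h ≤ 60) (hk : k < 60) :
    CountBounds h k (Nat.count (fun a => perm a < h) k)
      (Nat.count (fun a => perm a < h) (k + 1)) := by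
  simpa [perm] using (checkCounts_sound h permTable 0 0
    (checkCounts_permTable h (by omega))).1 k hk

theorem count_perm_lt {h : ℕ} (hh : h ≤ 60) : Nat.count (fun a => perm a < h) 60 = h := by
  have := (checkCounts_sound h permTable 0 0 (checkCounts_permTable h (by omega))).2
  rwa [zero_add] at this

theorem perm_lt {a : ℕ} (ha : a < 60) : perm a < 60 :=
  (by decide +kernel : ∀ a < 60, perm a < 60) a ha

theorem exists_perm_eq_iff {h : ℕ} (hh : h < 60) :
    ∃ a < 60, ∀ b < 60, perm b = h ↔ b = a := by
  have h1 : ∀ h < 60, permTable.idxOf h < 60 ∧ perm (permTable.idxOf h) = h := by decide +kernel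
  have h2 : ∀ b < 60, permTable.idxOf (perm b) = b := by decide +kernel
  refine ⟨permTable.idxOf h, (h1 h hh).1, fun b hb => ⟨?_, ?_⟩⟩
  · rintro rfl; exact (h2 b hb).symm
  · rintro rfl; exact (h1 h hh).2

theorem digitPerm_lt (n : ℕ) {a : ℕ} (ha : a < 60) : digitPerm n a < 60 := by
  have := perm_lt ha
  unfold digitPerm; split_ifs <;> omega

theorem exists_digitPerm_eq_iff (n : ℕ) {h : ℕ} (hh : h < 60) :
    ∃ a < 60, ∀ b < 60, digitPerm n b = h ↔ b = a := by
  unfold digitPerm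
  split_ifs
  · exact exists_perm_eq_iff hh
  · obtain ⟨a, ha, hab⟩ := exists_perm_eq_iff (h := 59 - h) (by omega)
    refine ⟨a, ha, fun b hb => ?_⟩
    rw [← hab b hb]
    have := perm_lt hb
    omega

/-- The number of `a < k` with `digitPerm n a < h`. -/
def digitCount (n k h : ℕ) : ℕ := Nat.count (fun a => digitPerm n a < h) k

theorem digitCount_of_even {n : ℕ} (hn : n / 50 % 2 = 0) (k h : ℕ) :
    digitCount n k h = Nat.count (fun a => perm a < h) k := by
  simp [digitCount, digitPerm, hn]

theorem digitCount_add_of_odd {n : ℕ} (hn : n / 50 % 2 ≠ 0) {k h : ℕ} (hk : k ≤ 60)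
    (hh : h ≤ 60) : digitCount n k h + Nat.count (fun a => perm a < 60 - h) k = k := by
  unfold digitCount
  induction k with
  | zero => simp
  | succ k ih =>
    have h1 := ih (by omega)
    have h2 := perm_lt (a := k) (by omega)
    rw [Nat.count_succ, Nat.count_succ]
    have h3 : digitPerm n k = 59 - perm k := by simp [digitPerm, hn]
    rw [h3]
    split_ifs <;> omega

theorem digitCount_sixty (n : ℕ) {h : ℕ} (hh : h ≤ 60) : digitCount n 60 h = h := by
  by_cases hn : n / 50 % 2 = 0
  · rw [digitCount_of_even hn, count_perm_lt hh]
  · have h1 := digitCount_add_of_odd hn (k := 60) le_rfl hh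
    have h2 := count_perm_lt (h := 60 - h) (by omega)
    omega

/-! ### Counting in residue classes -/

theorem count_and_mod_div {B c : ℕ} (hc : c < B) (p : ℕ → Prop) [DecidablePred p] (P R : ℕ)
    (hR : R ≤ B) :
    Nat.count (fun i => i % B = c ∧ p (i / B)) (B * P + R) =
      Nat.count p P + if c < R ∧ p P then 1 else 0 := by
  have hB : 0 < B := by omega
  have tail : ∀ P R : ℕ, R ≤ B →
      Nat.count (fun j => (B * P + j) % B = c ∧ p ((B * P + j) / B)) R =
        if c < R ∧ p P then 1 else 0 := by
    intro P R hR
    induction R with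
    | zero => simp
    | succ R ih =>
      rw [Nat.count_succ, ih (by omega), Nat.mul_add_mod, Nat.mod_eq_of_lt (by omega),
        Nat.mul_add_div hB, Nat.div_eq_of_lt (by omega), add_zero]
      by_cases hp : p P
      · simp only [hp, and_true]
        split_ifs <;> omega
      · simp [hp]
  have full : ∀ P : ℕ, Nat.count (fun i => i % B = c ∧ p (i / B)) (B * P) = Nat.count p P := by
    intro P
    induction P with
    | zero => simp
    | succ P ih =>
      rw [Nat.mul_succ, Nat.count_add, ih, tail P B le_rfl, Nat.count_succ]
      simp [hc]
  rw [Nat.count_add, full, tail P R hR]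

theorem count_digitPerm_mod (n Q k : ℕ) (hk : k ≤ 60) {h : ℕ} (hh : h ≤ 60) :
    Nat.count (fun q => digitPerm n (q % 60) < h) (60 * Q + k) = h * Q + digitCount n k h := by
  have tail : ∀ Q k : ℕ, k ≤ 60 →
      Nat.count (fun j => digitPerm n ((60 * Q + j) % 60) < h) k = digitCount n k h := by
    intro Q k hk
    induction k with
    | zero => simp [digitCount]
    | succ k ih =>
      rw [Nat.count_succ, ih (by omega), digitCount, digitCount, Nat.count_succ,
        Nat.mul_add_mod, Nat.mod_eq_of_lt (by omega)]
  have full : ∀ Q : ℕ, Nat.count (fun q => digitPerm n (q % 60) < h) (60 * Q) = h * Q := by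
    intro Q
    induction Q with
    | zero => simp
    | succ Q ih =>
      rw [Nat.mul_succ, Nat.count_add, ih, tail Q 60 le_rfl, digitCount_sixty n hh]
      ring
  rw [Nat.count_add, full, tail Q k hk]

theorem count_or_of_disjoint (p q r : ℕ → Prop) [DecidablePred p] [DecidablePred q]
    [DecidablePred r] (hr : ∀ i, r i ↔ p i ∨ q i) (hpq : ∀ i, ¬ (p i ∧ q i)) (N : ℕ) :
    Nat.count r N = Nat.count p N + Nat.count q N := by
  induction N with
  | zero => simp
  | succ N ih =>
    rw [Nat.count_succ, Nat.count_succ, Nat.count_succ, ih]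
    have h1 := hr N
    have h2 := hpq N
    by_cases hp : p N <;> by_cases hq : q N <;> simp_all <;> omega

/-! ### The reversed digit expansion -/

theorem rev_lt (n i : ℕ) : rev n i < 60 ^ n := by
  induction n with
  | zero => simp [rev]
  | succ n ih =>
    have := digitPerm_lt n (Nat.mod_lt (i / 60 ^ n) (by norm_num : 60 > 0))
    rw [rev, pow_succ]; omega

theorem exists_rev_eq_iff (n : ℕ) {v : ℕ} (hv : v < 60 ^ n) :
    ∃ c < 60 ^ n, ∀ i, rev n i = v ↔ i % 60 ^ n = c := by
  induction n generalizing v with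
  | zero =>
    refine ⟨0, by simp, fun i => ?_⟩
    have : v = 0 := by simpa using hv
    simp [rev, this, Nat.mod_one]
  | succ n ih =>
    have hv' : v / 60 < 60 ^ n := by rw [pow_succ] at hv; omega
    obtain ⟨c, hc, hci⟩ := ih hv'
    obtain ⟨a, ha, hab⟩ := exists_digitPerm_eq_iff n (Nat.mod_lt v (by norm_num : 60 > 0))
    refine ⟨c + 60 ^ n * a, ?_, fun i => ?_⟩
    · rw [pow_succ]; nlinarith
    · have hd := Nat.mod_lt (i / 60 ^ n) (by norm_num : 60 > 0)
      have h1 := digitPerm_lt n hd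
      have h2 : rev (n + 1) i = v ↔
          rev n i = v / 60 ∧ digitPerm n (i / 60 ^ n % 60) = v % 60 := by
        rw [rev]; omega
      rw [h2, hci, hab _ hd, pow_succ, Nat.mod_mul]
      have hm := Nat.mod_lt i (pow_pos (by norm_num : 0 < 60) n)
      constructor
      · rintro ⟨h3, h4⟩; rw [h3, h4]
      · intro h3
        have h4 := congrArg (· % 60 ^ n) h3
        have h5 := congrArg (· / 60 ^ n) h3
        have hB := pow_pos (by norm_num : 0 < 60) n
        simp only [Nat.add_mul_mod_self_left, Nat.add_mul_div_left _ _ hB,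
          Nat.mod_eq_of_lt hm, Nat.mod_eq_of_lt hc, Nat.div_eq_of_lt hm,
          Nat.div_eq_of_lt hc, zero_add] at h4 h5
        exact ⟨h4, h5⟩

/-! ### The discrepancy function at grid points -/

/-- The signed discrepancy of `rev n 0, …, rev n (N - 1)` with respect to `[0, w)`. -/
noncomputable def gridDisc (n w N : ℕ) : ℝ :=
  (Nat.count (fun i => rev n i < w) N : ℝ) - N * w / 60 ^ n

/-- The fractional part of `N / 60 ^ n`. -/
noncomputable def fracDiv (n N : ℕ) : ℝ := ((N % 60 ^ n : ℕ) : ℝ) / 60 ^ n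

theorem fracDiv_nonneg (n N : ℕ) : 0 ≤ fracDiv n N := by unfold fracDiv; positivity

theorem fracDiv_le_one (n N : ℕ) : fracDiv n N ≤ 1 := by
  unfold fracDiv
  rw [div_le_one (by positivity)]
  exact_mod_cast (Nat.mod_lt N (pow_pos (by norm_num : 0 < 60) n)).le

theorem fracDiv_succ (n N : ℕ) :
    fracDiv (n + 1) N = ((N / 60 ^ n % 60 : ℕ) + fracDiv n N) / 60 := by
  unfold fracDiv
  rw [pow_succ 60 n, Nat.mod_mul]
  push_cast
  field_simp
  ring

/-- The increment of `gridDisc` caused by the `n`-th digit, sixty times. -/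
noncomputable def increment (n k h : ℕ) (t : ℝ) : ℝ :=
  (1 - t) * (60 * digitCount n k h - h * k) + t * (60 * digitCount n (k + 1) h - h * (k + 1))

theorem gridDisc_succ (n N : ℕ) {w : ℕ} (hw : w ≤ 60 ^ (n + 1)) :
    ∃ w' ≤ 60 ^ n, ∃ h < 60, gridDisc (n + 1) w N =
      gridDisc n w' N + increment n (N / 60 ^ n % 60) h (fracDiv n N) / 60 := by
  have hdig : ∀ i, digitPerm n (i / 60 ^ n % 60) < 60 := fun i =>
    digitPerm_lt n (Nat.mod_lt _ (by norm_num))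
  have hB : 0 < 60 ^ n := by positivity
  by_cases hh0 : w % 60 = 0
  · refine ⟨w / 60, by rw [pow_succ] at hw; omega, 0, by norm_num, ?_⟩
    have h1 : Nat.count (fun i => rev (n + 1) i < w) N =
        Nat.count (fun i => rev n i < w / 60) N := by
      congr 1
      funext i
      have := hdig i
      rw [rev]
      apply propext
      omega
    have h2 : (w : ℝ) = 60 * (w / 60 : ℕ) := by
      have : w = 60 * (w / 60) := by omega
      exact_mod_cast this
    unfold gridDisc increment
    rw [h1, h2]
    simp only [digitCount, Nat.not_lt_zero, Nat.count_false]
    push_cast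
    rw [pow_succ]
    field_simp
    ring
  · have hw0 : w / 60 < 60 ^ n := by rw [pow_succ] at hw; omega
    have hh : w % 60 < 60 := Nat.mod_lt _ (by norm_num)
    obtain ⟨c, hc, hci⟩ := exists_rev_eq_iff n hw0
    set h := w % 60 with hhdef
    set w0 := w / 60 with hw0def
    set P := N / 60 ^ n with hP
    set R := N % 60 ^ n with hR
    set k := P % 60 with hk
    set Q := P / 60 with hQ
    have hRB : R < 60 ^ n := Nat.mod_lt _ hB
    have hk60 : k < 60 := Nat.mod_lt _ (by norm_num)
    have hN : N = 60 ^ n * P + R := (Nat.div_add_mod _ _).symm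
    have hPQ : P = 60 * Q + k := (Nat.div_add_mod _ _).symm
    have hwe : w = 60 * w0 + h := (Nat.div_add_mod _ _).symm
    have e1 : Nat.count (fun i => rev (n + 1) i < w) N = Nat.count (fun i => rev n i < w0) N +
        Nat.count (fun i => i % 60 ^ n = c ∧ digitPerm n (i / 60 ^ n % 60) < h) N := by
      apply count_or_of_disjoint
      · intro i
        have := hdig i
        rw [← hci, rev]
        omega
      · rintro i ⟨h1, h2, -⟩
        rw [← hci] at h2
        omega
    have e2 : Nat.count (fun i => i % 60 ^ n = c ∧ digitPerm n (i / 60 ^ n % 60) < h) N =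
        h * Q + digitCount n k h + if c < R ∧ digitPerm n k < h then 1 else 0 := by
      have := count_and_mod_div hc (fun q => digitPerm n (q % 60) < h) P R hRB.le
      rw [← hN] at this
      rw [this, ← count_digitPerm_mod n Q k hk60.le hh.le, ← hPQ]
    have e3 : Nat.count (fun i => rev n i < w0 + 1) N = Nat.count (fun i => rev n i < w0) N +
        (P + if c < R then 1 else 0) := by
      have := count_and_mod_div hc (fun _ => True) P R hRB.le
      rw [← hN] at this
      simp only [and_true, Nat.count_true] at this
      rw [← this]
      apply count_or_of_disjoint
      · intro i
        rw [← hci]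
        omega
      · rintro i ⟨h1, h2⟩
        rw [← hci] at h2
        omega
    have e4 : digitCount n (k + 1) h = digitCount n k h + if digitPerm n k < h then 1 else 0 := by
      rw [digitCount, Nat.count_succ]; rfl
    have hNr : (N : ℝ) = 60 ^ n * (60 * Q + k) + R := by
      have : N = 60 ^ n * (60 * Q + k) + R := by rw [← hPQ]; exact hN
      exact_mod_cast this
    have hwr : (w : ℝ) = 60 * w0 + h := by exact_mod_cast hwe
    have hPr : (P : ℝ) = 60 * Q + k := by exact_mod_cast hPQ
    have hBr : (60 : ℝ) ^ n ≠ 0 := by positivity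
    by_cases hd : digitPerm n k < h
    · refine ⟨w0 + 1, hw0, h, hh, ?_⟩
      unfold gridDisc increment fracDiv
      rw [e1, e2, e3, e4, ← hR]
      simp only [hd, and_true, if_true]
      push_cast
      rw [hNr, hwr, hPr, pow_succ]
      field_simp
      ring
    · refine ⟨w0, hw0.le, h, hh, ?_⟩
      unfold gridDisc increment fracDiv
      rw [e1, e2, e4, ← hR]
      simp only [hd, and_false, if_false]
      push_cast
      rw [hNr, hwr, pow_succ]
      field_simp
      ring

/-! ### Bounding the increments with a potential -/

/-- The potential controlling sums of increments along the digits of `N`. -/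
noncomputable def potential (t : ℝ) : ℝ := 0.23 * |t - 1 / 2|

theorem potential_nonneg (t : ℝ) : 0 ≤ potential t := by unfold potential; positivity

theorem potential_le {t : ℝ} (h0 : 0 ≤ t) (h1 : t ≤ 1) : potential t ≤ 0.115 := by
  have : |t - 1 / 2| ≤ 1 / 2 := by rw [abs_le]; constructor <;> linarith
  unfold potential; linarith

theorem CountBounds.interpolation {h k c c' : ℕ} (H : CountBounds h k c c') {t : ℝ}
    (h0 : 0 ≤ t) (h1 : t ≤ 1) :
    0 ≤ (1 - t) * (60 * (c : ℝ) - h * k) + t * (60 * c' - h * (k + 1)) ∧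
    ((1 - t) * (60 * (c : ℝ) - h * k) + t * (60 * c' - h * (k + 1))) / 60 ≤
      1.82 + potential t - potential ((k + t) / 60) := by
  obtain ⟨a1, a2, a3, a4, a5, a6, a7, a8⟩ := H
  have b1 : (h : ℝ) * k ≤ 60 * c := by exact_mod_cast a1
  have b2 : (h : ℝ) * (k + 1) ≤ 60 * c' := by exact_mod_cast a2
  have b3 : 6000 * (c : ℝ) + 23 * k ≤ 12300 + 100 * h * k := by exact_mod_cast a3
  have b4 : 6000 * (c : ℝ) ≤ 10920 + 23 * k + 100 * h * k := by exact_mod_cast a4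
  have b5 : 6000 * (c' : ℝ) + 23 * (k + 1) ≤ 12300 + 100 * h * (k + 1) := by exact_mod_cast a5
  have b6 : 6000 * (c' : ℝ) ≤ 10920 + 23 * (k + 1) + 100 * h * (k + 1) := by exact_mod_cast a6
  have b7 : 6000 * ((c : ℝ) + c') + 46 * k ≤ 23197 + 100 * h * (2 * k + 1) := by
    exact_mod_cast a7
  have b8 : 6000 * ((c : ℝ) + c') ≤ 20483 + 46 * k + 100 * h * (2 * k + 1) := by
    exact_mod_cast a8
  refine ⟨add_nonneg (mul_nonneg (by linarith) (by linarith))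
    (mul_nonneg h0 (by linarith)), ?_⟩
  unfold potential
  rcases le_total t (1 / 2) with ht | ht
  · rw [abs_of_nonpos (by linarith : t - 1 / 2 ≤ 0)]
    have ht' : 0 ≤ 1 - 2 * t := by linarith
    rcases abs_cases (((k : ℝ) + t) / 60 - 1 / 2) with ⟨e, -⟩ | ⟨e, -⟩ <;> rw [e]
    · linarith [mul_le_mul_of_nonneg_left b3 ht', mul_le_mul_of_nonneg_left b7 h0]
    · linarith [mul_le_mul_of_nonneg_left b4 ht', mul_le_mul_of_nonneg_left b8 h0]
  · rw [abs_of_nonneg (by linarith : 0 ≤ t - 1 / 2)]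
    have ht' : 0 ≤ 2 * t - 1 := by linarith
    have ht'' : 0 ≤ 1 - t := by linarith
    rcases abs_cases (((k : ℝ) + t) / 60 - 1 / 2) with ⟨e, -⟩ | ⟨e, -⟩ <;> rw [e]
    · linarith [mul_le_mul_of_nonneg_left b5 ht', mul_le_mul_of_nonneg_left b7 ht'']
    · linarith [mul_le_mul_of_nonneg_left b6 ht', mul_le_mul_of_nonneg_left b8 ht'']

theorem increment_of_even {n : ℕ} (hn : n / 50 % 2 = 0) {k h : ℕ} (hk : k < 60) (hh : h < 60)
    {t : ℝ} (h0 : 0 ≤ t) (h1 : t ≤ 1) :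
    0 ≤ increment n k h t ∧
      increment n k h t / 60 ≤ 1.82 + potential t - potential ((k + t) / 60) := by
  have := (perm_countBounds hh.le hk).interpolation h0 h1
  simpa only [increment, digitCount_of_even hn] using this

theorem increment_of_odd {n : ℕ} (hn : n / 50 % 2 ≠ 0) {k h : ℕ} (hk : k < 60) (hh : h < 60)
    {t : ℝ} (h0 : 0 ≤ t) (h1 : t ≤ 1) :
    increment n k h t ≤ 0 ∧
      -increment n k h t / 60 ≤ 1.82 + potential t - potential ((k + t) / 60) := by
  have H := (perm_countBounds (h := 60 - h) (by omega) hk).interpolation h0 h1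
  have c1 := digitCount_add_of_odd hn hk.le hh.le
  have c2 := digitCount_add_of_odd hn (k := k + 1) hk hh.le
  have r1 : (Nat.count (fun a => perm a < 60 - h) k : ℝ) = k - digitCount n k h := by
    rw [eq_sub_iff_add_eq']; exact_mod_cast c1
  have r2 : (Nat.count (fun a => perm a < 60 - h) (k + 1) : ℝ) =
      k + 1 - digitCount n (k + 1) h := by
    rw [eq_sub_iff_add_eq']; exact_mod_cast c2
  rw [r1, r2, Nat.cast_sub hh.le] at H
  have e : -increment n k h t = (1 - t) * (60 * ((k : ℝ) - digitCount n k h) -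
      ((60 : ℕ) - h) * k) + t * (60 * (k + 1 - digitCount n (k + 1) h) -
      ((60 : ℕ) - h) * (k + 1)) := by
    unfold increment; push_cast; ring
  rw [← e] at H
  exact ⟨by linarith [H.1], H.2⟩

/-! ### Bounding the discrepancy at grid points -/

/-- All grid discrepancies at level `n` lie in `[-b, a]`. -/
def GridBound (N n : ℕ) (a b : ℝ) : Prop :=
  ∀ w ≤ 60 ^ n, -b ≤ gridDisc n w N ∧ gridDisc n w N ≤ a

theorem gridBound_zero (N : ℕ) : GridBound N 0 0 0 := by
  intro w hw
  have : w = 0 ∨ w = 1 := by rw [pow_zero] at hw; omega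
  rcases this with rfl | rfl <;> simp [gridDisc, rev]

theorem GridBound.succ_of_even {N n : ℕ} (hn : n / 50 % 2 = 0) {a b : ℝ}
    (H : GridBound N n a b) :
    GridBound N (n + 1)
      (a + (1.82 + potential (fracDiv n N) - potential (fracDiv (n + 1) N))) b := by
  intro w hw
  obtain ⟨w', hw', h, hh, e⟩ := gridDisc_succ n N hw
  have h1 := increment_of_even hn (Nat.mod_lt (N / 60 ^ n) (by norm_num : 60 > 0)) hh
    (fracDiv_nonneg n N) (fracDiv_le_one n N)
  rw [← fracDiv_succ] at h1
  have h2 := H w' hw'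
  rw [e]
  constructor <;> linarith [h1.1, h1.2, h2.1, h2.2]

theorem GridBound.succ_of_odd {N n : ℕ} (hn : n / 50 % 2 ≠ 0) {a b : ℝ}
    (H : GridBound N n a b) :
    GridBound N (n + 1) a
      (b + (1.82 + potential (fracDiv n N) - potential (fracDiv (n + 1) N))) := by
  intro w hw
  obtain ⟨w', hw', h, hh, e⟩ := gridDisc_succ n N hw
  have h1 := increment_of_odd hn (Nat.mod_lt (N / 60 ^ n) (by norm_num : 60 > 0)) hh
    (fracDiv_nonneg n N) (fracDiv_le_one n N)
  rw [← fracDiv_succ] at h1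
  have h2 := H w' hw'
  rw [e]
  constructor <;> linarith [h1.1, h1.2, h2.1, h2.2]

theorem GridBound.add_hundred {N q : ℕ} {a b : ℝ} (H : GridBound N (100 * q) a b) :
    GridBound N (100 * (q + 1)) (a + 91.115) (b + 91.115) := by
  have even : ∀ i ≤ 50, GridBound N (100 * q + i)
      (a + (1.82 * i + potential (fracDiv (100 * q) N) -
        potential (fracDiv (100 * q + i) N))) b := by
    intro i hi
    induction i with
    | zero => simpa using H
    | succ i ih =>
      have := (ih (by omega)).succ_of_even (by omega)
      rw [Nat.cast_succ i, ← Nat.add_assoc]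
      convert this using 1
      ring
  have odd : ∀ i ≤ 50, GridBound N (100 * q + 50 + i)
      (a + (1.82 * (50 : ℕ) + potential (fracDiv (100 * q) N) -
        potential (fracDiv (100 * q + 50) N)))
      (b + (1.82 * i + potential (fracDiv (100 * q + 50) N) -
        potential (fracDiv (100 * q + 50 + i) N))) := by
    intro i hi
    induction i with
    | zero => simpa using even 50 le_rfl
    | succ i ih =>
      have := (ih (by omega)).succ_of_odd (by omega)
      rw [Nat.cast_succ i, ← Nat.add_assoc]
      convert this using 1
      ring
  intro w hw
  have h1 := odd 50 le_rfl w (by rwa [show 100 * q + 50 + 50 = 100 * (q + 1) by ring])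
  have h2 : gridDisc (100 * q + 50 + 50) w N = gridDisc (100 * (q + 1)) w N := by
    rw [show 100 * q + 50 + 50 = 100 * (q + 1) by ring]
  rw [h2] at h1
  push_cast at h1
  have p1 := potential_le (fracDiv_nonneg (100 * q) N) (fracDiv_le_one (100 * q) N)
  have p2 := potential_le (fracDiv_nonneg (100 * q + 50) N) (fracDiv_le_one (100 * q + 50) N)
  have p3 := potential_nonneg (fracDiv (100 * q + 50) N)
  have p4 := potential_nonneg (fracDiv (100 * q + 50 + 50) N)
  constructor <;> linarith [h1.1, h1.2]

theorem gridBound_hundred_mul (N q : ℕ) :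
    GridBound N (100 * q) (91.115 * q) (91.115 * q) := by
  induction q with
  | zero => simpa using gridBound_zero N
  | succ q ih =>
    have := ih.add_hundred
    convert this using 1 <;> · push_cast; ring

/-! ### The sequence -/

/-- The generalized van der Corput sequence with digit permutations `digitPerm`. -/
noncomputable def permSeq (i : ℕ) : ℝ := ⨆ n, (rev n i : ℝ) / 60 ^ n

theorem monotone_rev_div (i : ℕ) : Monotone fun n => (rev n i : ℝ) / 60 ^ n := by
  refine monotone_nat_of_le_succ fun n => ?_
  rw [rev, pow_succ, div_le_div_iff₀ (by positivity) (by positivity)]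
  push_cast
  have : (0 : ℝ) ≤ digitPerm n (i / 60 ^ n % 60) * 60 ^ n := by positivity
  linarith

theorem antitone_rev_add_one_div (i : ℕ) : Antitone fun n => ((rev n i : ℝ) + 1) / 60 ^ n := by
  refine antitone_nat_of_succ_le fun n => ?_
  have h1 : digitPerm n (i / 60 ^ n % 60) + 1 ≤ 60 :=
    digitPerm_lt n (Nat.mod_lt _ (by norm_num))
  have h2 : (digitPerm n (i / 60 ^ n % 60) : ℝ) + 1 ≤ 60 := by exact_mod_cast h1
  rw [rev, pow_succ, div_le_div_iff₀ (by positivity) (by positivity)]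
  push_cast
  have := mul_le_mul_of_nonneg_right h2 (by positivity : (0 : ℝ) ≤ 60 ^ n)
  linarith

theorem rev_div_le_rev_add_one_div (i m n : ℕ) :
    (rev m i : ℝ) / 60 ^ m ≤ (rev n i + 1) / 60 ^ n :=
  calc (rev m i : ℝ) / 60 ^ m ≤ rev (max m n) i / 60 ^ max m n :=
        monotone_rev_div i (le_max_left m n)
    _ ≤ (rev (max m n) i + 1) / 60 ^ max m n := by gcongr; linarith
    _ ≤ (rev n i + 1) / 60 ^ n := antitone_rev_add_one_div i (le_max_right m n)

theorem permSeq_le (n i : ℕ) : permSeq i ≤ (rev n i + 1) / 60 ^ n :=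
  ciSup_le fun m => rev_div_le_rev_add_one_div i m n

theorem le_permSeq (n i : ℕ) : (rev n i : ℝ) / 60 ^ n ≤ permSeq i :=
  le_ciSup (f := fun n => (rev n i : ℝ) / 60 ^ n)
    ⟨_, by rintro _ ⟨m, rfl⟩; exact rev_div_le_rev_add_one_div i m 0⟩ n

theorem permSeq_nonneg (i : ℕ) : 0 ≤ permSeq i := by simpa [rev] using le_permSeq 0 i

theorem permSeq_lt_one (i : ℕ) : permSeq i < 1 := by
  have hi : i < 60 ^ (100 * i) :=
    (Nat.lt_pow_self (by norm_num : 1 < 60)).trans_le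
      (Nat.pow_le_pow_right (by norm_num) (by omega))
  have h1 : rev (100 * i + 1) i + 1 < 60 ^ (100 * i + 1) := by
    have h2 := rev_lt (100 * i) i
    rw [rev, Nat.div_eq_of_lt hi, pow_succ]
    have h3 : digitPerm (100 * i) (0 % 60) = 0 := by
      rw [digitPerm, if_pos (by omega)]; rfl
    omega
  refine (permSeq_le (100 * i + 1) i).trans_lt ?_
  rw [div_lt_one (by positivity)]
  exact_mod_cast h1

open Classical in
theorem abs_count_permSeq_sub_le {N n : ℕ} (hN : N ≤ 60 ^ n) {a : ℝ} (H : GridBound N n a a)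
    {v : ℝ} (hv0 : 0 < v) (hv1 : v ≤ 1) :
    |(Nat.count (fun i => permSeq i < v) N : ℝ) - N * v| ≤ a + 1 := by
  have hB : (0 : ℝ) < 60 ^ n := by positivity
  set w := ⌈v * 60 ^ n⌉₊ with hw
  have hw0 : 0 < w := Nat.ceil_pos.mpr (by positivity)
  have hw1 : w ≤ 60 ^ n := by
    rw [hw, Nat.ceil_le]; push_cast; nlinarith
  have hwl : v * 60 ^ n ≤ w := Nat.le_ceil _
  have hwu : ((w - 1 : ℕ) : ℝ) < v * 60 ^ n := Nat.lt_ceil.mp (by omega)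
  have hwc : ((w - 1 : ℕ) : ℝ) = w - 1 := by rw [Nat.cast_sub hw0]; simp
  have c1 : Nat.count (fun i => permSeq i < v) N ≤ Nat.count (fun i => rev n i < w) N := by
    refine Nat.count_mono_left fun i _ hi => ?_
    rw [hw, Nat.lt_ceil, ← div_lt_iff₀ hB]
    exact (le_permSeq n i).trans_lt hi
  have c2 : Nat.count (fun i => rev n i < w - 1) N ≤ Nat.count (fun i => permSeq i < v) N := by
    refine Nat.count_mono_left fun i _ hi => ?_
    refine (permSeq_le n i).trans_lt ?_
    rw [div_lt_iff₀ hB]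
    refine lt_of_le_of_lt ?_ hwu
    exact_mod_cast hi
  have c1' : (Nat.count (fun i => permSeq i < v) N : ℝ) ≤ Nat.count (fun i => rev n i < w) N := by
    exact_mod_cast c1
  have c2' : (Nat.count (fun i => rev n i < w - 1) N : ℝ) ≤
      Nat.count (fun i => permSeq i < v) N := by
    exact_mod_cast c2
  have g1 := (H w hw1).2
  have g2 := (H (w - 1) (by omega)).1
  unfold gridDisc at g1 g2
  have hNB : (N : ℝ) / 60 ^ n ≤ 1 := by
    rw [div_le_one hB]; exact_mod_cast hN
  have hN0 : (0 : ℝ) ≤ N / 60 ^ n := by positivity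
  have u1 : (N : ℝ) * w / 60 ^ n ≤ N * v + 1 := by
    have := mul_le_mul_of_nonneg_left (show (w : ℝ) ≤ v * 60 ^ n + 1 by linarith) hN0
    have e : (N : ℝ) / 60 ^ n * (v * 60 ^ n + 1) = N * v + N / 60 ^ n := by field_simp
    rw [e] at this
    rw [mul_div_right_comm]
    linarith
  have u2 : (N : ℝ) * v - 1 ≤ N * (w - 1 : ℕ) / 60 ^ n := by
    have := mul_le_mul_of_nonneg_left (show v * 60 ^ n - 1 ≤ ((w - 1 : ℕ) : ℝ) by linarith) hN0
    have e : (N : ℝ) / 60 ^ n * (v * 60 ^ n - 1) = N * v - N / 60 ^ n := by field_simp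
    rw [e] at this
    rw [mul_div_right_comm]
    linarith
  rw [abs_le]
  constructor <;> linarith

theorem starDisc1_permSeq_le {N n : ℕ} (hN0 : 0 < N) (hN : N ≤ 60 ^ n) {a : ℝ}
    (H : GridBound N n a a) : starDisc1 permSeq N ≤ (a + 1) / N := by
  classical
  have hNr : (0 : ℝ) < N := by exact_mod_cast hN0
  refine csSup_le ⟨_, 1, one_pos, le_rfl, rfl⟩ ?_
  rintro _ ⟨v, hv0, hv1, rfl⟩
  have hc : Nat.card {i : ℕ // i < N ∧ 0 ≤ permSeq i ∧ permSeq i < v} =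
      Nat.count (fun i => permSeq i < v) N := by
    simp only [permSeq_nonneg, true_and]
    rw [Nat.count_eq_card_fintype]
    let := Nat.CountSet.fintype (fun i => permSeq i < v) N
    exact Nat.card_eq_fintype_card
  rw [hc, div_sub' hNr.ne', abs_div, abs_of_pos hNr]
  gcongr
  exact abs_count_permSeq_sub_le hN H hv0 hv1

theorem log_sixty_gt : (4.09 : ℝ) < Real.log 60 := by
  have h : Real.exp (45 : ℕ) < (60 : ℝ) ^ 11 := by
    rw [← Real.exp_one_pow]
    exact (pow_lt_pow_left₀ Real.exp_one_lt_d9 (Real.exp_pos 1).le (by norm_num)).trans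
      (by norm_num)
  rw [← Real.lt_log_iff_exp_lt (by norm_num), Real.log_pow] at h
  push_cast at h
  linarith

theorem stmt12 :
    ∃ x : ℕ → ℝ, (∀ n, x n ∈ Set.Ico (0 : ℝ) 1) ∧
      ∃ N₀ : ℕ, ∀ N : ℕ, N₀ ≤ N →
        starDisc1 x N ≤ 0.223 * Real.log N / N := by
  refine ⟨permSeq, fun i => ⟨permSeq_nonneg i, permSeq_lt_one i⟩, ?_⟩
  obtain ⟨N₀, hN₀⟩ := Filter.eventually_atTop.mp
    ((Real.tendsto_log_atTop.comp tendsto_natCast_atTop_atTop).eventually_ge_atTop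
      (1000000 : ℝ))
  refine ⟨max N₀ 1, fun N hN => ?_⟩
  have hlog : 1000000 ≤ Real.log N := hN₀ N (le_trans (le_max_left _ _) hN)
  have hN1 : 0 < N := le_trans (le_max_right _ _) hN
  have hNr : (0 : ℝ) < N := by exact_mod_cast hN1
  have h60 := log_sixty_gt
  set q := ⌈Real.log N / 409⌉₊ with hq
  have hq1 : Real.log N / 409 ≤ q := Nat.le_ceil _
  have hq2 : (q : ℝ) < Real.log N / 409 + 1 := Nat.ceil_lt_add_one (by positivity)
  have hpow : N ≤ 60 ^ (100 * q) := by
    have : Real.log N ≤ Real.log ((60 : ℝ) ^ (100 * q)) := by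
      rw [Real.log_pow]
      push_cast
      have := mul_le_mul_of_nonneg_left h60.le (by positivity : (0 : ℝ) ≤ 100 * q)
      linarith
    have := (Real.log_le_log_iff hNr (by positivity)).mp this
    exact_mod_cast this
  refine (starDisc1_permSeq_le hN1 hpow (gridBound_hundred_mul N q)).trans ?_
  gcongr
  linarith
end

section
/- Let q be a prime and let f = (f_1,…,f_d) be a d-tuple of elements of the field Z_q((x^{−1})) of formal Laurent series over Z_q. The digital Kronecker sequence S(f) = (x_n)_{n≥0}, where x_n = ({n(x)f_1(x)}|_{x=q}, …, {n(x)f_d(x)}|_{x=q}), is uniformly distributed in [0,1)^d if and only if 1, f_1,…,f_d are linearly independent over the polynomial ring Z_q[x]. -/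
open Real

/-- The discrepancy of the first `N` points of a sequence `z` in `[0,1)^ι`. -/
noncomputable def disc {ι : Type*} [Fintype ι] (z : ℕ → ι → ℝ) (N : ℕ) : ℝ :=
  sSup { r : ℝ | ∃ u v : ι → ℝ,
    (∀ i, 0 ≤ u i ∧ u i ≤ v i ∧ v i ≤ 1) ∧
    r = |(Nat.card {n : ℕ // n < N ∧ ∀ i, u i ≤ z n i ∧ z n i < v i} : ℝ) / N
          - ∏ i, (v i - u i)| }

/-- The polynomial `n(x) = n₀ + n₁x + ⋯ ∈ (ZMod q)[x]` associated with the
base-`q` digit expansion `n = n₀ + n₁q + ⋯` of a nonnegative integer `n`. -/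
noncomputable def natPoly (q n : ℕ) : Polynomial (ZMod q) :=
  ∑ i ∈ Finset.range (Nat.digits q n).length,
    Polynomial.C ((Nat.digits q n).getD i 0 : ZMod q) * Polynomial.X ^ i

/-- The embedding of `(ZMod q)[x]` into the field `ZMod q((x⁻¹))` of formal
Laurent series in `x⁻¹`; we realize `ZMod q((x⁻¹))` as `LaurentSeries (ZMod q)`
(Hahn series over `ℤ`) in the variable `X = x⁻¹`, so `x ↦ single (-1) 1`. -/
noncomputable def polyToLS {q : ℕ} (p : Polynomial (ZMod q)) : LaurentSeries (ZMod q) :=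
  p.eval₂ HahnSeries.C (HahnSeries.single (-1 : ℤ) 1)

/-- The digital Kronecker sequence `S(f)` for `f = (f_1, …, f_d)` in
`(ZMod q((x⁻¹)))^d`: the `j`-th coordinate of the `n`-th point is the fractional
part of `n(x)·f_j(x)` (the part with the coefficients of `x^{-k}`, `k ≥ 1`)
evaluated at `x = q`; in the variable `X = x⁻¹` the coefficient of `x^{-k}`
is the coefficient of `X^k`. -/
noncomputable def digitalKroneckerLS {q : ℕ} (d : ℕ)
    (f : Fin d → LaurentSeries (ZMod q)) (n : ℕ) : Fin d → ℝ :=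
  fun j => ∑' k : ℕ,
    (((polyToLS (natPoly q n) * f j).coeff ((k : ℤ) + 1)).val : ℝ) / (q : ℝ) ^ (k + 1)

section NatPoly

variable {q : ℕ} [Fact q.Prime]

lemma natPoly_coeff (n i : ℕ) : (natPoly q n).coeff i = ((n / q ^ i : ℕ) : ZMod q) := by
  have hq : 2 ≤ q := (Fact.out : q.Prime).two_le
  have h : (natPoly q n).coeff i = ((Nat.digits q n).getD i 0 : ZMod q) := by
    simp only [natPoly, Polynomial.finsetSum_coeff, Polynomial.coeff_C_mul_X_pow]
    rw [Finset.sum_ite_eq]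
    split_ifs with hi
    · rfl
    · rw [List.getD_eq_default _ _ (by simpa using hi)]
      simp
  rw [h, Nat.getD_digits _ _ hq, ZMod.natCast_mod]

lemma natPoly_coeff_eq_zero {n s i : ℕ} (hn : n < q ^ s) (hi : s ≤ i) :
    (natPoly q n).coeff i = 0 := by
  have hq : 0 < q := (Fact.out : q.Prime).pos
  rw [natPoly_coeff, Nat.div_eq_of_lt (hn.trans_le (Nat.pow_le_pow_right hq hi)), Nat.cast_zero]

lemma natPoly_injective : Function.Injective (natPoly q) := by
  have hq : 2 ≤ q := (Fact.out : q.Prime).two_le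
  intro n
  induction n using Nat.strong_induction_on with
  | _ n ih =>
    intro n' h
    have hc : ∀ i, ((n / q ^ i : ℕ) : ZMod q) = ((n' / q ^ i : ℕ) : ZMod q) := fun i => by
      rw [← natPoly_coeff, ← natPoly_coeff, h]
    have h0 : n % q = n' % q := by
      simpa using (ZMod.natCast_eq_natCast_iff' _ _ _).1 (hc 0)
    have hdiv : natPoly q (n / q) = natPoly q (n' / q) := by
      ext i
      rw [natPoly_coeff, natPoly_coeff, Nat.div_div_eq_div_mul, Nat.div_div_eq_div_mul,
        ← pow_succ', hc]
    rcases Nat.eq_zero_or_pos n with rfl | hn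
    · by_contra hne
      have hn' : n' ≠ 0 := fun h => hne h.symm
      have hnat : ∀ i, q ∣ n' / q ^ i := fun i => by
        rw [← ZMod.natCast_eq_zero_iff, ← hc i]
        simp
      have hlog := hnat (Nat.log q n')
      have h1 : 0 < n' / q ^ Nat.log q n' := Nat.div_pos (Nat.pow_log_le_self q hn') (by positivity)
      have h2 : n' / q ^ Nat.log q n' < q := by
        rw [Nat.div_lt_iff_lt_mul (by positivity), ← pow_succ']
        exact Nat.lt_pow_succ_log_self hq n'
      exact absurd (Nat.le_of_dvd h1 hlog) (by omega)
    · have hd := ih (n / q) (Nat.div_lt_self hn hq) hdiv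
      rw [← Nat.div_add_mod n q, ← Nat.div_add_mod n' q, hd, h0]

lemma natPoly_surjective : Function.Surjective (natPoly q) := by
  have hq : 0 < q := (Fact.out : q.Prime).pos
  have key : ∀ (s : ℕ) (P : Polynomial (ZMod q)), (∀ i, s ≤ i → P.coeff i = 0) →
      ∃ n, natPoly q n = P := by
    intro s
    induction s with
    | zero =>
      refine fun P hP => ⟨0, ?_⟩
      ext i
      rw [natPoly_coeff, hP i (Nat.zero_le i)]
      simp
    | succ s ih =>
      intro P hP
      obtain ⟨n, hn⟩ := ih P.divX fun i hi => by
        rw [Polynomial.coeff_divX]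
        exact hP _ (by omega)
      have hv : (P.coeff 0).val < q := ZMod.val_lt _
      refine ⟨q * n + (P.coeff 0).val, ?_⟩
      ext i
      rw [natPoly_coeff]
      cases i with
      | zero => simp
      | succ i =>
        rw [pow_succ', ← Nat.div_div_eq_div_mul, Nat.mul_add_div hq, Nat.div_eq_of_lt hv, add_zero,
          ← natPoly_coeff, hn, Polynomial.coeff_divX]
  exact fun P => key (P.natDegree + 1) P fun i hi =>
    Polynomial.coeff_eq_zero_of_natDegree_lt (by omega)

lemma lt_pow_of_natPoly_coeff_eq_zero {n s : ℕ}
    (h : ∀ i, s ≤ i → (natPoly q n).coeff i = 0) : n < q ^ s := by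
  have hq : 0 < q := (Fact.out : q.Prime).pos
  have hmod : n % q ^ s < q ^ s := Nat.mod_lt _ (by positivity)
  suffices n = n % q ^ s by omega
  apply natPoly_injective (q := q)
  ext i
  rcases lt_or_ge i s with hi | hi
  · obtain ⟨t, rfl⟩ : ∃ t, s = i + (t + 1) := ⟨s - i - 1, by omega⟩
    rw [natPoly_coeff, natPoly_coeff]
    conv_lhs => rw [← Nat.div_add_mod n (q ^ (i + (t + 1)))]
    rw [pow_add, mul_assoc, Nat.mul_add_div (by positivity), pow_succ']
    simp
  · rw [h i hi, natPoly_coeff_eq_zero hmod hi]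

lemma natPoly_mul_pow_add (a : ℕ) {b s : ℕ} (hb : b < q ^ s) :
    natPoly q (q ^ s * a + b) = Polynomial.X ^ s * natPoly q a + natPoly q b := by
  have hq : 0 < q := (Fact.out : q.Prime).pos
  ext i
  rw [Polynomial.coeff_add, Polynomial.coeff_X_pow_mul']
  split_ifs with hi
  · obtain ⟨t, rfl⟩ := Nat.exists_eq_add_of_le hi
    rw [natPoly_coeff_eq_zero hb hi, natPoly_coeff, natPoly_coeff, pow_add,
      ← Nat.div_div_eq_div_mul, Nat.mul_add_div (by positivity), Nat.div_eq_of_lt hb]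
    simp
  · obtain ⟨t, rfl⟩ : ∃ t, s = i + (t + 1) := ⟨s - i - 1, by omega⟩
    rw [natPoly_coeff, natPoly_coeff, pow_add, mul_assoc, Nat.mul_add_div (by positivity), pow_succ']
    simp

end NatPoly

section PolyToLS

variable {q : ℕ}

lemma polyToLS_add (p r : Polynomial (ZMod q)) : polyToLS (p + r) = polyToLS p + polyToLS r :=
  Polynomial.eval₂_add _ _

lemma polyToLS_mul (p r : Polynomial (ZMod q)) : polyToLS (p * r) = polyToLS p * polyToLS r :=
  Polynomial.eval₂_mul _ _

lemma coeff_polyToLS_mul {p : Polynomial (ZMod q)} {m : ℕ} (hp : p.natDegree < m)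
    (g : LaurentSeries (ZMod q)) (n : ℤ) :
    (polyToLS p * g).coeff n = ∑ i ∈ Finset.range m, p.coeff i * g.coeff (n + i) := by
  have h : polyToLS p = ∑ i ∈ Finset.range m, HahnSeries.single (-(i : ℤ)) (p.coeff i) := by
    rw [polyToLS, Polynomial.eval₂_eq_sum_range' _ hp]
    refine Finset.sum_congr rfl fun i _ => ?_
    rw [HahnSeries.single_pow, HahnSeries.C_apply, HahnSeries.single_mul_single]
    simp
  rw [h, Finset.sum_mul, HahnSeries.coeff_sum]
  refine Finset.sum_congr rfl fun i _ => ?_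
  rw [HahnSeries.coeff_single_mul, sub_neg_eq_add]

lemma coeff_polyToLS_of_pos (p : Polynomial (ZMod q)) {n : ℤ} (hn : 0 < n) :
    (polyToLS p).coeff n = 0 := by
  rw [← mul_one (polyToLS p), coeff_polyToLS_mul (Nat.lt_succ_self _)]
  refine Finset.sum_eq_zero fun i _ => ?_
  rw [HahnSeries.coeff_one, if_neg (by omega), mul_zero]

lemma coeff_polyToLS_neg (p : Polynomial (ZMod q)) (k : ℕ) :
    (polyToLS p).coeff (-(k : ℤ)) = p.coeff k := by
  rw [← mul_one (polyToLS p),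
    coeff_polyToLS_mul (m := p.natDegree + k + 1) (by omega), Finset.sum_eq_single k]
  · simp
  · intro i _ hi
    rw [HahnSeries.coeff_one, if_neg (by omega), mul_zero]
  · intro h
    exact absurd (Finset.mem_range.2 (by omega)) h

lemma polyToLS_injective : Function.Injective (polyToLS (q := q)) := fun p r h => by
  ext k
  rw [← coeff_polyToLS_neg, h, coeff_polyToLS_neg]

/-- A Laurent series whose fractional part vanishes is a polynomial in `x`. -/
lemma exists_polyToLS_eq (g : LaurentSeries (ZMod q)) (h : ∀ i : ℕ, g.coeff ((i : ℤ) + 1) = 0) :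
    ∃ p, polyToLS p = g := by
  obtain ⟨b, hb⟩ : ∃ b : ℤ, ∀ n < b, g.coeff n = 0 :=
    ⟨g.order, fun n hn => HahnSeries.coeff_eq_zero_of_lt_order hn⟩
  refine ⟨∑ i ∈ Finset.range (b.natAbs + 1), Polynomial.monomial i (g.coeff (-(i : ℤ))), ?_⟩
  ext n
  rcases lt_or_ge 0 n with hn | hn
  · rw [coeff_polyToLS_of_pos _ hn, ← h (n - 1).toNat]
    congr 1
    omega
  · obtain ⟨k, rfl⟩ : ∃ k : ℕ, n = -(k : ℤ) := ⟨n.natAbs, by omega⟩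
    rw [coeff_polyToLS_neg]
    simp only [Polynomial.finsetSum_coeff, Polynomial.coeff_monomial]
    rw [Finset.sum_ite_eq']
    split_ifs with hk
    · rfl
    · rw [Finset.mem_range] at hk
      exact (hb _ (by omega)).symm

end PolyToLS

section DigitMap

variable {q d : ℕ}

/-- The first `m` digits of each coordinate of the point attached to the polynomial `P`. -/
noncomputable def digitMap (f : Fin d → LaurentSeries (ZMod q)) (m : ℕ) :
    Polynomial (ZMod q) →+ (Fin d → Fin m → ZMod q) where
  toFun P j k := (polyToLS P * f j).coeff (((k : ℕ) : ℤ) + 1)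
  map_zero' := by
    ext j k
    simp [polyToLS]
  map_add' P R := by
    ext j k
    simp [polyToLS_add, add_mul]

/-- The pairing of the digits with the coefficients of polynomials `p j` of degree less than `m`
reads off the first fractional digit of `P * ∑ j, p j * f j`. -/
lemma coeff_one_polyToLS_mul_sum (f : Fin d → LaurentSeries (ZMod q)) {m : ℕ}
    {p : Fin d → Polynomial (ZMod q)} (hp : ∀ j, (p j).natDegree < m) (P : Polynomial (ZMod q)) :
    (polyToLS P * ∑ j, polyToLS (p j) * f j).coeff 1 =
      ∑ j, ∑ k : Fin m, (p j).coeff k * digitMap f m P j k := by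
  rw [Finset.mul_sum, HahnSeries.coeff_sum]
  refine Finset.sum_congr rfl fun j _ => ?_
  rw [mul_left_comm, coeff_polyToLS_mul (hp j), Finset.sum_range]
  refine Finset.sum_congr rfl fun k _ => ?_
  rw [add_comm (1 : ℤ)]
  rfl

lemma digitMap_surjective [Fact q.Prime] {f : Fin d → LaurentSeries (ZMod q)}
    (hf : ∀ (p₀ : Polynomial (ZMod q)) (p : Fin d → Polynomial (ZMod q)),
      polyToLS p₀ + ∑ j, polyToLS (p j) * f j = 0 → p₀ = 0 ∧ ∀ j, p j = 0)
    {m : ℕ} (hm : 0 < m) : Function.Surjective (digitMap f m) := by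
  let L := (digitMap f m).toZModLinearMap q
  suffices LinearMap.range L = ⊤ from LinearMap.range_eq_top.1 this
  by_contra hne
  obtain ⟨φ, hφ, hker⟩ := Submodule.exists_le_ker_of_lt_top _ (lt_top_iff_ne_top.2 hne)
  let c : Fin d → Fin m → ZMod q := fun j k => φ (Pi.single j (Pi.single k 1))
  have hφc : ∀ v, φ v = ∑ j, ∑ k, c j k * v j k := fun v => by
    have hv : v = ∑ j, ∑ k, v j k • (Pi.single j (Pi.single k 1) : Fin d → Fin m → ZMod q) := by
      ext j k
      simp [Finset.sum_apply, Pi.single_apply, ite_apply]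
    conv_lhs => rw [hv]
    simp only [map_sum, map_smul, smul_eq_mul]
    exact Finset.sum_congr rfl fun j _ => Finset.sum_congr rfl fun k _ => mul_comm _ _
  let p : Fin d → Polynomial (ZMod q) := fun j => ∑ k : Fin m, Polynomial.monomial (k : ℕ) (c j k)
  have hdeg : ∀ j, (p j).natDegree < m := fun j => by
    refine lt_of_le_of_lt (Polynomial.natDegree_sum_le_of_forall_le (n := m - 1) _ _
      fun k _ => (Polynomial.natDegree_monomial_le _).trans ?_) (by omega)
    have := k.2
    omega
  have hcoeff : ∀ j (k : Fin m), (p j).coeff k = c j k := fun j k => by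
    simp only [p, Polynomial.finsetSum_coeff, Polynomial.coeff_monomial]
    simp [Fin.val_inj]
  have hzero : ∀ P, (polyToLS P * ∑ j, polyToLS (p j) * f j).coeff 1 = 0 := fun P => by
    have h0 : φ (digitMap f m P) = 0 := hker ⟨P, rfl⟩
    rw [coeff_one_polyToLS_mul_sum f hdeg, ← h0, hφc]
    simp only [hcoeff]
  obtain ⟨p₀, hp₀⟩ := exists_polyToLS_eq (∑ j, polyToLS (p j) * f j) fun i => by
    rw [← hzero (Polynomial.X ^ i),
      coeff_polyToLS_mul (m := i + 1) (by simp)]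
    simp [Polynomial.coeff_X_pow, add_comm]
  have hrel := hf (-p₀) p (by
    rw [← hp₀, ← polyToLS_add, neg_add_cancel]
    simp [polyToLS])
  apply hφ
  refine LinearMap.ext fun v => ?_
  rw [hφc]
  simp [← hcoeff, hrel.2]

lemma eq_zero_of_digitMap_surjective {f : Fin d → LaurentSeries (ZMod q)}
    (hf : ∀ m, Function.Surjective (digitMap f m))
    {p₀ : Polynomial (ZMod q)} {p : Fin d → Polynomial (ZMod q)}
    (hrel : polyToLS p₀ + ∑ j, polyToLS (p j) * f j = 0) : p₀ = 0 ∧ ∀ j, p j = 0 := by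
  let m := Finset.univ.sup (fun j => (p j).natDegree) + 1
  have hdeg : ∀ j, (p j).natDegree < m := fun j =>
    Nat.lt_succ_of_le (Finset.le_sup (f := fun j => (p j).natDegree) (Finset.mem_univ j))
  have hp : ∀ j, p j = 0 := fun j => by
    ext k
    rcases lt_or_ge k m with hk | hk
    · obtain ⟨P, hP⟩ := hf m (Pi.single j (Pi.single ⟨k, hk⟩ 1))
      have h := coeff_one_polyToLS_mul_sum f hdeg P
      rw [← neg_eq_iff_add_eq_zero.2 hrel, mul_neg, ← polyToLS_mul, HahnSeries.coeff_neg,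
        coeff_polyToLS_of_pos _ one_pos, neg_zero, hP] at h
      simpa [Pi.single_apply, ite_apply] using h.symm
    · exact Polynomial.coeff_eq_zero_of_natDegree_lt ((hdeg j).trans_le hk)
  refine ⟨polyToLS_injective ?_, hp⟩
  simpa [hp, polyToLS] using hrel

end DigitMap

section Counting

variable {q : ℕ} [Fact q.Prime] {V : Type*} [AddCommGroup V] [DecidableEq V]

lemma count_fiber_le (L : Polynomial (ZMod q) →+ V) {s : ℕ}
    (hs : ∀ τ, ∃ b < q ^ s, L (natPoly q b) = τ) (τ τ' : V) :
    Nat.count (fun b => L (natPoly q b) = τ) (q ^ s) ≤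
      Nat.count (fun b => L (natPoly q b) = τ') (q ^ s) := by
  obtain ⟨c, hc, hcτ⟩ := hs (τ' - τ)
  choose g hg using fun b => natPoly_surjective (q := q) (natPoly q b + natPoly q c)
  rw [Nat.count_eq_card_filter_range, Nat.count_eq_card_filter_range]
  refine Finset.card_le_card_of_injOn g (fun b hb => ?_) fun b _ b' _ h => ?_
  · obtain ⟨hb, hbτ⟩ := Finset.mem_filter.1 hb
    refine Finset.mem_filter.2 ⟨Finset.mem_range.2 (lt_pow_of_natPoly_coeff_eq_zero fun i hi => ?_),
      ?_⟩
    · rw [hg, Polynomial.coeff_add, natPoly_coeff_eq_zero (Finset.mem_range.1 hb) hi,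
        natPoly_coeff_eq_zero hc hi, add_zero]
    · rw [hg, map_add, hbτ, hcτ, add_sub_cancel]
  · apply natPoly_injective (q := q)
    simpa [hg] using congrArg (natPoly q) h

lemma count_fiber_block (L : Polynomial (ZMod q) →+ V) {s : ℕ}
    (hs : ∀ τ, ∃ b < q ^ s, L (natPoly q b) = τ) (a : ℕ) (τ : V) :
    Nat.count (fun b => L (natPoly q (q ^ s * a + b)) = τ) (q ^ s) =
      Nat.count (fun b => L (natPoly q b) = 0) (q ^ s) := by
  rw [← (count_fiber_le L hs (τ - L (Polynomial.X ^ s * natPoly q a)) 0).antisymm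
    (count_fiber_le L hs _ _), Nat.count_eq_card_filter_range, Nat.count_eq_card_filter_range]
  congr 1
  refine Finset.filter_congr fun b hb => ?_
  rw [natPoly_mul_pow_add a (Finset.mem_range.1 hb), map_add, eq_sub_iff_add_eq, add_comm]

lemma count_mem_block (L : Polynomial (ZMod q) →+ V) {s : ℕ}
    (hs : ∀ τ, ∃ b < q ^ s, L (natPoly q b) = τ) (T : Finset V) (a : ℕ) :
    Nat.count (fun b => L (natPoly q (q ^ s * a + b)) ∈ T) (q ^ s) =
      T.card * Nat.count (fun b => L (natPoly q b) = 0) (q ^ s) := by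
  rw [Nat.count_eq_card_filter_range, Finset.card_eq_sum_card_fiberwise (t := T)
    (f := fun b => L (natPoly q (q ^ s * a + b))) fun b hb => Finset.mem_coe.2 (Finset.mem_filter.1 hb).2,
    Finset.sum_const_nat fun τ hτ => ?_]
  rw [← count_fiber_block L hs a τ, Nat.count_eq_card_filter_range, Finset.filter_filter]
  congr 1
  refine Finset.filter_congr fun b _ => ?_
  exact ⟨fun h => h.2, fun h => ⟨by simpa only [h] using hτ, h⟩⟩

lemma count_mem_mul_pow (L : Polynomial (ZMod q) →+ V) {s : ℕ}
    (hs : ∀ τ, ∃ b < q ^ s, L (natPoly q b) = τ) (T : Finset V) (a : ℕ) :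
    Nat.count (fun n => L (natPoly q n) ∈ T) (q ^ s * a) =
      a * (T.card * Nat.count (fun b => L (natPoly q b) = 0) (q ^ s)) := by
  induction a with
  | zero => simp
  | succ a ih => rw [mul_add_one, Nat.count_add, ih, count_mem_block L hs, add_one_mul]

/-- A surjective additive map to a finite group equidistributes the polynomials `natPoly q n`,
uniformly over all target sets. -/
lemma exists_abs_count_div_sub_le [Fintype V] {L : Polynomial (ZMod q) →+ V}
    (hL : Function.Surjective L) :
    ∃ C : ℝ, ∀ (N : ℕ), 0 < N → ∀ T : Finset V,
      |(Nat.count (fun n => L (natPoly q n) ∈ T) N : ℝ) / N - T.card / Fintype.card V| ≤ C / N := by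
  have hq : q.Prime := Fact.out
  obtain ⟨s, hs⟩ : ∃ s, ∀ τ, ∃ b < q ^ s, L (natPoly q b) = τ := by
    choose b hb using hL.comp (natPoly_surjective (q := q))
    refine ⟨Finset.univ.sup b, fun τ => ⟨b τ, ?_, hb τ⟩⟩
    exact (Nat.lt_pow_self hq.one_lt).trans_le
      (Nat.pow_le_pow_right hq.pos (Finset.le_sup (Finset.mem_univ τ)))
  have hcount := count_mem_mul_pow L hs
  set κ := Nat.count (fun b => L (natPoly q b) = 0) (q ^ s)
  have hQ : 0 < q ^ s := pow_pos hq.pos s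
  have hV : q ^ s = Fintype.card V * κ := by
    simpa [Nat.count_eq_card_filter_range] using hcount Finset.univ 1
  refine ⟨(q ^ s : ℕ), fun N hN T => ?_⟩
  have hN' : (0 : ℝ) < N := by exact_mod_cast hN
  have hcard : (0 : ℝ) < Fintype.card V := by exact_mod_cast Fintype.card_pos
  have hTV : T.card * κ ≤ q ^ s := hV ▸ Nat.mul_le_mul_right _ (Finset.card_le_univ T)
  have hmod := Nat.div_add_mod N (q ^ s)
  have hlt := Nat.mod_lt N hQ
  set a := N / q ^ s
  generalize N % q ^ s = r at hmod hlt
  have hlow : a * (T.card * κ) ≤ Nat.count (fun n => L (natPoly q n) ∈ T) N := by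
    rw [← hcount]
    exact Nat.count_monotone _ (by omega)
  have hup : Nat.count (fun n => L (natPoly q n) ∈ T) N ≤ (a + 1) * (T.card * κ) := by
    rw [← hcount]
    exact Nat.count_monotone _ (by rw [mul_add_one]; omega)
  set c := Nat.count (fun n => L (natPoly q n) ∈ T) N
  have hratio : (T.card : ℝ) / Fintype.card V = (T.card * κ : ℕ) / (q ^ s : ℕ) := by
    have hκ : (κ : ℝ) ≠ 0 := by
      rintro h0
      rw [Nat.cast_eq_zero.1 h0] at hV
      omega
    rw [hV]
    push_cast
    rw [mul_div_mul_right _ _ hκ]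
  rw [hratio]
  generalize T.card * κ = K at *
  generalize q ^ s = Q at *
  have hQ' : (0 : ℝ) < Q := by exact_mod_cast hQ
  have h1 : (a : ℝ) * K ≤ c := by exact_mod_cast hlow
  have h2 : (c : ℝ) ≤ (a + 1) * K := by exact_mod_cast hup
  have h3 : (K : ℝ) ≤ Q := by exact_mod_cast hTV
  have h4 : (Q : ℝ) * a ≤ N := by exact_mod_cast (by omega : Q * a ≤ N)
  have h5 : (N : ℝ) ≤ Q * a + Q := by exact_mod_cast (by omega : N ≤ Q * a + Q)
  have h6 : (K : ℝ) / Q * Q = K := div_mul_cancel₀ _ hQ'.ne'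
  have h7 : 0 ≤ (K : ℝ) / Q := by positivity
  have hkey : |(c : ℝ) - K / Q * N| ≤ Q := by
    rw [abs_le]
    constructor <;> nlinarith
  rw [show (c : ℝ) / N - K / Q = (c - K / Q * N) / N by field_simp, abs_div, abs_of_pos hN']
  gcongr

end Counting

section Digits

open Finset

variable {q : ℕ}

/-- Digit strings of length `m`, most significant digit first, as numbers below `q ^ m`. -/
noncomputable def digitEquiv (q : ℕ) [NeZero q] (m : ℕ) : (Fin m → ZMod q) ≃ Fin (q ^ m) :=
  (Equiv.arrowCongr Fin.revPerm (Equiv.ofBijective (fun x : ZMod q => (⟨x.val, x.val_lt⟩ : Fin q))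
    ((Fintype.bijective_iff_injective_and_card _).2
      ⟨fun _ _ h => ZMod.val_injective q (Fin.mk.inj h), by simp [ZMod.card]⟩))).trans
    finFunctionFinEquiv

lemma digitEquiv_div [NeZero q] {m : ℕ} (w : Fin m → ZMod q) :
    ((digitEquiv q m w : ℕ) : ℝ) / (q : ℝ) ^ m =
      ∑ k : Fin m, ((w k).val : ℝ) / (q : ℝ) ^ ((k : ℕ) + 1) := by
  have hq : (q : ℝ) ≠ 0 := Nat.cast_ne_zero.2 (NeZero.ne q)
  have h : (digitEquiv q m w : ℕ) = ∑ i : Fin m, (w i.rev).val * q ^ (i : ℕ) := rfl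
  rw [h, ← Equiv.sum_comp Fin.revPerm]
  push_cast
  rw [Finset.sum_div]
  refine Finset.sum_congr rfl fun k _ => ?_
  rw [Fin.revPerm_apply, Fin.rev_rev, Fin.val_rev, div_eq_div_iff (by positivity) (by positivity),
    mul_assoc, ← pow_add]
  congr 2
  omega

lemma sum_le_tsum_digits [NeZero q] (a : ℕ → ZMod q) (m : ℕ) :
    ∑ k : Fin m, ((a k).val : ℝ) / (q : ℝ) ^ ((k : ℕ) + 1) ≤
        ∑' k : ℕ, ((a k).val : ℝ) / (q : ℝ) ^ (k + 1) ∧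
      ∑' k : ℕ, ((a k).val : ℝ) / (q : ℝ) ^ (k + 1) ≤
        ∑ k : Fin m, ((a k).val : ℝ) / (q : ℝ) ^ ((k : ℕ) + 1) + 1 / (q : ℝ) ^ m := by
  let D : ℕ → Fin q := fun k => ⟨(a k).val, (a k).val_lt⟩
  have h : ∑' k : ℕ, ((a k).val : ℝ) / (q : ℝ) ^ (k + 1) = Real.ofDigits D :=
    tsum_congr fun k => div_eq_mul_inv _ _
  have h' : ∑ k : Fin m, ((a k).val : ℝ) / (q : ℝ) ^ ((k : ℕ) + 1) =
      ∑ k ∈ range m, Real.ofDigitsTerm D k := by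
    rw [Finset.sum_range]
    exact Finset.sum_congr rfl fun k _ => div_eq_mul_inv _ _
  rw [h, h', Real.ofDigits_eq_sum_add_ofDigits D m, one_div]
  have h0 : (0 : ℝ) ≤ ((q : ℝ) ^ m)⁻¹ := by positivity
  constructor
  · linarith [mul_nonneg h0 (Real.ofDigits_nonneg fun i => D (i + m))]
  · linarith [mul_le_of_le_one_right h0 (Real.ofDigits_le_one fun i => D (i + m))]

lemma digitalKroneckerLS_mem_Icc [NeZero q] {d : ℕ} (f : Fin d → LaurentSeries (ZMod q)) (m n : ℕ)
    (j : Fin d) :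
    ((digitEquiv q m (digitMap f m (natPoly q n) j) : ℕ) : ℝ) ≤
        digitalKroneckerLS d f n j * (q : ℝ) ^ m ∧
      digitalKroneckerLS d f n j * (q : ℝ) ^ m ≤
        (digitEquiv q m (digitMap f m (natPoly q n) j) : ℕ) + 1 := by
  have hq : (0 : ℝ) < (q : ℝ) ^ m := by
    have := Nat.pos_of_neZero q
    positivity
  have h := sum_le_tsum_digits (fun k : ℕ => (polyToLS (natPoly q n) * f j).coeff ((k : ℤ) + 1)) m
  have he := digitEquiv_div (digitMap f m (natPoly q n) j)
  simp only [digitMap, AddMonoidHom.coe_mk, ZeroHom.coe_mk] at he ⊢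
  rw [← he] at h
  rw [← div_le_iff₀ hq, ← le_div_iff₀ hq, add_div]
  exact h

lemma sub_two_le_card_filter [NeZero q] {m : ℕ} {u v : ℝ} (hu : 0 ≤ u) (hv : v ≤ (q : ℝ) ^ m) :
    v - u - 2 ≤ (#{w : Fin m → ZMod q | u ≤ (digitEquiv q m w : ℕ) ∧
      ((digitEquiv q m w : ℕ) : ℝ) + 1 < v} : ℝ) := by
  have h : #(Ico ⌈u⌉₊ (⌈v⌉₊ - 1)) ≤ #{w : Fin m → ZMod q | u ≤ (digitEquiv q m w : ℕ) ∧
      ((digitEquiv q m w : ℕ) : ℝ) + 1 < v} := by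
    refine card_le_card_of_surjOn (fun w => (digitEquiv q m w : ℕ)) fun x hx => ?_
    rw [coe_Ico, Set.mem_Ico] at hx
    have hxv : (x : ℝ) + 1 < v := by
      have : x + 1 < ⌈v⌉₊ := by omega
      exact_mod_cast Nat.lt_ceil.1 this
    have hxq : x < q ^ m := by
      have : (x : ℝ) < (q : ℝ) ^ m := by linarith
      exact_mod_cast this
    refine ⟨(digitEquiv q m).symm ⟨x, hxq⟩, ?_, by simp⟩
    simpa using ⟨Nat.ceil_le.1 hx.1, hxv⟩
  rw [Nat.card_Ico] at h
  have h1 : ⌈v⌉₊ ≤ #{w : Fin m → ZMod q | u ≤ (digitEquiv q m w : ℕ) ∧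
      ((digitEquiv q m w : ℕ) : ℝ) + 1 < v} + 1 + ⌈u⌉₊ := by omega
  have h2 := Nat.cast_le (α := ℝ).2 h1
  push_cast at h2
  linarith [Nat.le_ceil v, Nat.ceil_lt_add_one hu]

lemma card_filter_le_add_two [NeZero q] {m : ℕ} {u v : ℝ} (hu : 0 ≤ u) (huv : u ≤ v) :
    (#{w : Fin m → ZMod q | u ≤ ((digitEquiv q m w : ℕ) : ℝ) + 1 ∧
      ((digitEquiv q m w : ℕ) : ℝ) < v} : ℝ) ≤ v - u + 2 := by
  have h : #{w : Fin m → ZMod q | u ≤ ((digitEquiv q m w : ℕ) : ℝ) + 1 ∧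
      ((digitEquiv q m w : ℕ) : ℝ) < v} ≤ #(Ico (⌈u⌉₊ - 1) ⌈v⌉₊) := by
    refine card_le_card_of_injOn (fun w => (digitEquiv q m w : ℕ)) (fun w hw => ?_)
      fun w _ w' _ h => (digitEquiv q m).injective (Fin.ext h)
    rw [coe_filter_univ, Set.mem_ofPred_eq] at hw
    rw [coe_Ico, Set.mem_Ico]
    refine ⟨?_, Nat.lt_ceil.2 hw.2⟩
    have : ⌈u⌉₊ ≤ (digitEquiv q m w : ℕ) + 1 := Nat.ceil_le.2 (by exact_mod_cast hw.1)
    simp only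
    omega
  rw [Nat.card_Ico] at h
  have h1 : #{w : Fin m → ZMod q | u ≤ ((digitEquiv q m w : ℕ) : ℝ) + 1 ∧
      ((digitEquiv q m w : ℕ) : ℝ) < v} + ⌈u⌉₊ ≤ ⌈v⌉₊ + 1 := by
    have := Nat.ceil_mono huv
    omega
  have h2 := Nat.cast_le (α := ℝ).2 h1
  push_cast at h2
  linarith [Nat.le_ceil u, Nat.ceil_lt_add_one (hu.trans huv)]

end Digits

section Discrepancy

open Finset Filter

lemma prod_le_prod_add_card_mul {ι : Type*} (s : Finset ι) {a b : ι → ℝ} {ε : ℝ} (hε : 0 ≤ ε)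
    (ha : ∀ i, 0 ≤ a i ∧ a i ≤ 1) (hb : ∀ i, 0 ≤ b i ∧ b i ≤ 1) (hab : ∀ i, a i ≤ b i + ε) :
    ∏ i ∈ s, a i ≤ ∏ i ∈ s, b i + #s * ε := by
  classical
  induction s using Finset.induction_on with
  | empty => simp
  | insert i s hi ih =>
    rw [prod_insert hi, prod_insert hi, card_insert_of_notMem hi]
    have hA0 : 0 ≤ ∏ i ∈ s, a i := prod_nonneg fun i _ => (ha i).1
    have hA1 : ∏ i ∈ s, a i ≤ 1 := prod_le_one (fun i _ => (ha i).1) fun i _ => (ha i).2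
    have hs : 0 ≤ #s * ε := by positivity
    push_cast
    nlinarith [mul_le_mul_of_nonneg_right (hab i) hA0, mul_le_mul_of_nonneg_left ih (hb i).1,
      mul_le_of_le_one_right hε hA1, mul_le_of_le_one_left hs (hb i).2]

lemma disc_nonneg {ι : Type*} [Fintype ι] (z : ℕ → ι → ℝ) (N : ℕ) : 0 ≤ disc z N :=
  Real.sSup_nonneg (by rintro _ ⟨u, v, -, rfl⟩; exact abs_nonneg _)

lemma card_box_eq_count {ι : Type*} (z : ℕ → ι → ℝ) (N : ℕ) (u v : ι → ℝ)
    [DecidablePred fun n => ∀ i, u i ≤ z n i ∧ z n i < v i] :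
    Nat.card {n : ℕ // n < N ∧ ∀ i, u i ≤ z n i ∧ z n i < v i} =
      Nat.count (fun n => ∀ i, u i ≤ z n i ∧ z n i < v i) N := by
  rw [Nat.count_eq_card_fintype, Fintype.card_eq_nat_card]

lemma abs_le_disc {ι : Type*} [Fintype ι] (z : ℕ → ι → ℝ) (N : ℕ) {u v : ι → ℝ}
    (h : ∀ i, 0 ≤ u i ∧ u i ≤ v i ∧ v i ≤ 1) :
    |(Nat.card {n : ℕ // n < N ∧ ∀ i, u i ≤ z n i ∧ z n i < v i} : ℝ) / N
      - ∏ i, (v i - u i)| ≤ disc z N := by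
  classical
  refine le_csSup ⟨1, ?_⟩ ⟨u, v, h, rfl⟩
  rintro _ ⟨u, v, h, rfl⟩
  have h1 : 0 ≤ ∏ i, (v i - u i) := prod_nonneg fun i _ => by linarith [h i]
  have h2 : ∏ i, (v i - u i) ≤ 1 :=
    prod_le_one (fun i _ => by linarith [h i]) fun i _ => by linarith [h i]
  rw [card_box_eq_count]
  have h3 : (Nat.count (fun n => ∀ i, u i ≤ z n i ∧ z n i < v i) N : ℝ) / N ≤ 1 :=
    div_le_one_of_le₀ (Nat.cast_le.2 (Nat.count_le _)) (Nat.cast_nonneg _)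
  have h4 : 0 ≤ (Nat.count (fun n => ∀ i, u i ≤ z n i ∧ z n i < v i) N : ℝ) / N := by positivity
  rw [abs_le]
  constructor <;> linarith

variable {q d : ℕ} [Fact q.Prime] {f : Fin d → LaurentSeries (ZMod q)}

lemma exists_disc_le {m : ℕ} (hL : Function.Surjective (digitMap f m)) :
    ∃ C : ℝ, ∀ N, 0 < N →
      disc (digitalKroneckerLS d f) N ≤ d * (2 / (q : ℝ) ^ m) + C / N := by
  classical
  obtain ⟨C, hC⟩ := exists_abs_count_div_sub_le hL
  refine ⟨C, fun N hN => ?_⟩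
  have hq : (0 : ℝ) < q := Nat.cast_pos.2 (Fact.out : q.Prime).pos
  have hM : (0 : ℝ) < (q : ℝ) ^ m := by positivity
  have hN' : (0 : ℝ) < N := Nat.cast_pos.2 hN
  have hC0 : 0 ≤ C / N := (abs_nonneg _).trans (hC N hN ∅)
  refine Real.sSup_le ?_ (by positivity)
  rintro _ ⟨u, v, huv, rfl⟩
  rw [card_box_eq_count]
  let t : (Fin m → ZMod q) → ℝ := fun w => ((digitEquiv q m w : ℕ) : ℝ)
  let S : Fin d → Finset (Fin m → ZMod q) := fun j =>
    {w | u j * (q : ℝ) ^ m ≤ t w ∧ t w + 1 < v j * (q : ℝ) ^ m}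
  let S' : Fin d → Finset (Fin m → ZMod q) := fun j =>
    {w | u j * (q : ℝ) ^ m ≤ t w + 1 ∧ t w < v j * (q : ℝ) ^ m}
  have hratio : ∀ S : Fin d → Finset (Fin m → ZMod q),
      (#(Fintype.piFinset S) : ℝ) / Fintype.card (Fin d → Fin m → ZMod q) =
        ∏ j, (#(S j) : ℝ) / (q : ℝ) ^ m := fun S => by
    rw [Fintype.card_piFinset, prod_div_distrib]
    simp [ZMod.card]
  have hunit : ∀ (S : Fin d → Finset (Fin m → ZMod q)) j,
      0 ≤ (#(S j) : ℝ) / (q : ℝ) ^ m ∧ (#(S j) : ℝ) / (q : ℝ) ^ m ≤ 1 := fun S j => by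
    refine ⟨by positivity, div_le_one_of_le₀ ?_ hM.le⟩
    have := card_le_univ (S j)
    simp only [Fintype.card_fun, ZMod.card, Fintype.card_fin] at this
    exact_mod_cast this
  have hbox : ∀ j, 0 ≤ v j - u j ∧ v j - u j ≤ 1 := fun j => by
    have := huv j
    constructor <;> linarith
  have hε : (0 : ℝ) ≤ 2 / (q : ℝ) ^ m := by positivity
  have hlow : ∏ j, (v j - u j) ≤ ∏ j, (#(S j) : ℝ) / (q : ℝ) ^ m + d * (2 / (q : ℝ) ^ m) := by
    have := prod_le_prod_add_card_mul univ hε hbox (hunit S) fun j => by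
      obtain ⟨h0, h1, h2⟩ := huv j
      rw [← add_div, le_div_iff₀ hM]
      have := sub_two_le_card_filter (q := q) (m := m) (u := u j * (q : ℝ) ^ m)
        (v := v j * (q : ℝ) ^ m) (by positivity) (mul_le_of_le_one_left hM.le h2)
      change _ ≤ (#(S j) : ℝ) at this
      linarith
    simpa using this
  have hup : ∏ j, (#(S' j) : ℝ) / (q : ℝ) ^ m ≤ ∏ j, (v j - u j) + d * (2 / (q : ℝ) ^ m) := by
    have := prod_le_prod_add_card_mul univ hε (hunit S') hbox fun j => by
      obtain ⟨h0, h1, h2⟩ := huv j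
      rw [div_le_iff₀ hM, add_mul, div_mul_cancel₀ _ hM.ne']
      have := card_filter_le_add_two (q := q) (m := m) (u := u j * (q : ℝ) ^ m)
        (v := v j * (q : ℝ) ^ m) (by positivity) (mul_le_mul_of_nonneg_right h1 hM.le)
      change (#(S' j) : ℝ) ≤ _ at this
      linarith
    simpa using this
  have hS := abs_le.1 (hC N hN (Fintype.piFinset S))
  have hS' := abs_le.1 (hC N hN (Fintype.piFinset S'))
  rw [hratio] at hS hS'
  set z := digitalKroneckerLS d f
  have hz := digitalKroneckerLS_mem_Icc f m
  have hcount : (Nat.count (fun n => digitMap f m (natPoly q n) ∈ Fintype.piFinset S) N : ℝ) / N ≤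
      (Nat.count (fun n => ∀ i, u i ≤ z n i ∧ z n i < v i) N : ℝ) / N := by
    refine div_le_div_of_nonneg_right (Nat.cast_le.2 (Nat.count_mono_left fun n _ hn i => ?_)) hN'.le
    have h := (mem_filter.1 (Fintype.mem_piFinset.1 hn i)).2
    exact ⟨le_of_mul_le_mul_right (h.1.trans (hz n i).1) hM,
      lt_of_mul_lt_mul_right ((hz n i).2.trans_lt h.2) hM.le⟩
  have hcount' : (Nat.count (fun n => ∀ i, u i ≤ z n i ∧ z n i < v i) N : ℝ) / N ≤
      (Nat.count (fun n => digitMap f m (natPoly q n) ∈ Fintype.piFinset S') N : ℝ) / N := by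
    refine div_le_div_of_nonneg_right (Nat.cast_le.2 (Nat.count_mono_left fun n _ hn =>
      Fintype.mem_piFinset.2 fun i => ?_)) hN'.le
    exact mem_filter.2 ⟨mem_univ _, (mul_le_mul_of_nonneg_right (hn i).1 hM.le).trans (hz n i).2,
      (hz n i).1.trans_lt (mul_lt_mul_of_pos_right (hn i).2 hM)⟩
  rw [abs_le]
  constructor <;> linarith

lemma tendsto_disc_of_surjective (hL : ∀ m, 0 < m → Function.Surjective (digitMap f m)) :
    Tendsto (fun N => disc (digitalKroneckerLS d f) N) atTop (nhds 0) := by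
  have hq : 1 < (q : ℝ) := Nat.one_lt_cast.2 (Fact.out : q.Prime).one_lt
  have hlim : Tendsto (fun m : ℕ => d * (2 / (q : ℝ) ^ m)) atTop (nhds 0) := by
    simpa using (tendsto_const_nhds.div_atTop (tendsto_pow_atTop_atTop_of_one_lt hq)).const_mul
      (d : ℝ)
  refine tendsto_order.2 ⟨fun ε hε => Eventually.of_forall fun N => hε.trans_le (disc_nonneg _ _),
    fun ε hε => ?_⟩
  obtain ⟨m, hmε, hm⟩ :=
    ((hlim.eventually_lt_const (half_pos hε)).and (eventually_gt_atTop 0)).exists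
  obtain ⟨C, hC⟩ := exists_disc_le (hL m hm)
  filter_upwards [(tendsto_const_div_atTop_nhds_zero_nat C).eventually_lt_const (half_pos hε),
    eventually_gt_atTop 0] with N hN hN0
  linarith [hC N hN0]

lemma digitMap_surjective_of_tendsto_disc
    (h : Tendsto (fun N => disc (digitalKroneckerLS d f) N) atTop (nhds 0)) (m : ℕ) :
    Function.Surjective (digitMap f m) := by
  intro τ
  by_contra! hτ
  have hq : (0 : ℝ) < q := Nat.cast_pos.2 (Fact.out : q.Prime).pos
  have hM : (0 : ℝ) < (q : ℝ) ^ m := by positivity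
  let t : Fin d → ℕ := fun j => digitEquiv q m (τ j)
  let u : Fin d → ℝ := fun j => (t j + 1 / 2) / (q : ℝ) ^ m
  let v : Fin d → ℝ := fun j => (t j + 1) / (q : ℝ) ^ m
  have huv : ∀ i, 0 ≤ u i ∧ u i ≤ v i ∧ v i ≤ 1 := fun i => by
    refine ⟨by positivity, ?_, (div_le_one hM).2 ?_⟩
    · simp only [u, v]
      gcongr
      norm_num
    · have : t i + 1 ≤ q ^ m := (digitEquiv q m (τ i)).2
      exact_mod_cast this
  have hvol : ∏ i, (v i - u i) = (1 / 2 / (q : ℝ) ^ m) ^ d := by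
    have : ∀ i, v i - u i = 1 / 2 / (q : ℝ) ^ m := fun i => by
      simp only [u, v]
      ring
    simp only [this, prod_const, card_univ, Fintype.card_fin]
  have hpos : 0 < (1 / 2 / (q : ℝ) ^ m) ^ d := by positivity
  obtain ⟨N, hN⟩ := (h.eventually_lt_const hpos).exists
  have hempty : IsEmpty {n : ℕ // n < N ∧
      ∀ i, u i ≤ digitalKroneckerLS d f n i ∧ digitalKroneckerLS d f n i < v i} := by
    refine ⟨fun ⟨n, _, hn⟩ => hτ (natPoly q n) (funext fun j => ?_)⟩
    obtain ⟨h1, h2⟩ := hn j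
    obtain ⟨h3, h4⟩ := digitalKroneckerLS_mem_Icc f m n j
    rw [div_le_iff₀ hM] at h1
    rw [lt_div_iff₀ hM] at h2
    apply (digitEquiv q m).injective
    apply Fin.ext
    have h5 : (digitEquiv q m (digitMap f m (natPoly q n) j) : ℕ) < t j + 1 := by
      exact_mod_cast h3.trans_lt h2
    have h6 : (t j : ℝ) < ((digitEquiv q m (digitMap f m (natPoly q n) j) : ℕ) + 1 : ℕ) := by
      push_cast
      linarith
    have h7 := Nat.cast_lt.1 h6
    change _ = t j
    omega
  have hle := abs_le_disc (digitalKroneckerLS d f) N huv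
  rw [Nat.card_of_isEmpty, hvol, Nat.cast_zero, zero_div, zero_sub, abs_neg, abs_of_pos hpos] at hle
  linarith

end Discrepancy

theorem stmt18 (q : ℕ) (hq : q.Prime) (d : ℕ) (f : Fin d → LaurentSeries (ZMod q)) :
    Filter.Tendsto (fun N => disc (digitalKroneckerLS d f) N) Filter.atTop (nhds 0) ↔
      ∀ (p₀ : Polynomial (ZMod q)) (p : Fin d → Polynomial (ZMod q)),
        polyToLS p₀ + ∑ j, polyToLS (p j) * f j = 0 →
          p₀ = 0 ∧ ∀ j, p j = 0 := by
  have : Fact q.Prime := ⟨hq⟩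
  exact ⟨fun h _ _ => eq_zero_of_digitMap_surjective (digitMap_surjective_of_tendsto_disc h),
    fun hf => tendsto_disc_of_surjective fun _ => digitMap_surjective hf⟩
end
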